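/- arXiv:math/0604610 — 3 statements merged into one kernel-verified Lean document; each statement's English description precedes it below -/
import Mathlib

section
/- In the quantum matrix algebra M_q(n), for K, L ⊆ {1,...,n} of equal cardinality m, the quantum minor D^K_L = Σ_{σ ∈ Σ_m} (-q)^{ℓ(σ)} t^{k₁}_{l_{σ(1)}} ⋯ t^{k_m}_{l_{σ(m)}} commutes with every generator t^k_l whose row index k lies in K and whose column index l lies in L: t^k_l D^K_L = D^K_L t^k_l. -/
open scoped BigOperators

/-- The defining relations of the quantum matrix bialgebra `M_q(n)`. -/
inductive QMatRel (k : Type*) [Field k] (q : k) (n : ℕ) :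
    FreeAlgebra k (Fin n × Fin n) → FreeAlgebra k (Fin n × Fin n) → Prop
  | row (a : Fin n) {c d : Fin n} (h : c < d) :
      QMatRel k q n (FreeAlgebra.ι k (a, c) * FreeAlgebra.ι k (a, d))
        (q • (FreeAlgebra.ι k (a, d) * FreeAlgebra.ι k (a, c)))
  | col {a b : Fin n} (c : Fin n) (h : a < b) :
      QMatRel k q n (FreeAlgebra.ι k (a, c) * FreeAlgebra.ι k (b, c))
        (q • (FreeAlgebra.ι k (b, c) * FreeAlgebra.ι k (a, c)))
  | cross1 {a b c d : Fin n} (hab : a < b) (hcd : c < d) :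
      QMatRel k q n (FreeAlgebra.ι k (a, c) * FreeAlgebra.ι k (b, d))
        (FreeAlgebra.ι k (b, d) * FreeAlgebra.ι k (a, c) +
          (q - q⁻¹) • (FreeAlgebra.ι k (b, c) * FreeAlgebra.ι k (a, d)))
  | cross2 {a b c d : Fin n} (hab : a < b) (hdc : d < c) :
      QMatRel k q n (FreeAlgebra.ι k (a, c) * FreeAlgebra.ι k (b, d))
        (FreeAlgebra.ι k (b, d) * FreeAlgebra.ι k (a, c))

/-- The quantum matrix algebra `M_q(n)`. -/
abbrev QMat (k : Type*) [Field k] (q : k) (n : ℕ) : Type _ := RingQuot (QMatRel k q n)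

/-- The generator `t^i_j` of `M_q(n)`. -/
noncomputable def tgen {k : Type*} [Field k] (q : k) (n : ℕ) (i j : Fin n) : QMat k q n :=
  RingQuot.mkAlgHom k (QMatRel k q n) (FreeAlgebra.ι k (i, j))

/-- Number of inversions of a permutation of `Fin m`. -/
def invCount {m : ℕ} (σ : Equiv.Perm (Fin m)) : ℕ :=
  (Finset.univ.filter (fun p : Fin m × Fin m => p.1 < p.2 ∧ σ p.2 < σ p.1)).card

/-- The quantum minor `D^K_L` with row set `K` and column set `L` (both of
cardinality `m`, taken in increasing order). -/
noncomputable def qMinor {k : Type*} [Field k] (q : k) {n : ℕ} (m : ℕ)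
    (K L : Finset (Fin n)) (hK : K.card = m) (hL : L.card = m) : QMat k q n :=
  ∑ σ : Equiv.Perm (Fin m), ((-q) ^ invCount σ) •
    (List.ofFn (fun i : Fin m =>
      tgen q n (K.orderIsoOfFin hK i) (L.orderIsoOfFin hL (σ i)))).prod

/-- The defining relations of a `q`-generic matrix, over arbitrary ordered index types. -/
structure IsQMatrix {k A I J : Type*} [Field k] [Ring A] [Algebra k A] [LT I] [LT J]
    (q : k) (x : I → J → A) : Prop where
  row : ∀ a {c d}, c < d → x a c * x a d = q • (x a d * x a c)
  col : ∀ {a b} c, a < b → x a c * x b c = q • (x b c * x a c)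
  cross₁ : ∀ {a b c d}, a < b → c < d →
    x a c * x b d = x b d * x a c + (q - q⁻¹) • (x b c * x a d)
  cross₂ : ∀ {a b c d}, a < b → d < c → x a c * x b d = x b d * x a c

/-- The quantum determinant of a square matrix with noncommuting entries. -/
def qDet {k A : Type*} [Field k] [Ring A] [Algebra k A] (q : k) {m : ℕ}
    (x : Fin m → Fin m → A) : A :=
  ∑ σ : Equiv.Perm (Fin m), (-q) ^ invCount σ • (List.ofFn fun i => x i (σ i)).prod

section Permutations

/-- The permutation of `Fin (m + 1)` sending `0` to `j` and acting as `τ` on the rest. -/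
def consPerm {m : ℕ} (j : Fin (m + 1)) (τ : Equiv.Perm (Fin m)) : Equiv.Perm (Fin (m + 1)) :=
  (finSuccEquiv' 0).trans ((Equiv.optionCongr τ).trans (finSuccEquiv' j).symm)

@[simp]
lemma consPerm_zero {m : ℕ} (j : Fin (m + 1)) (τ : Equiv.Perm (Fin m)) :
    consPerm j τ 0 = j := by
  simp [consPerm]

@[simp]
lemma consPerm_succ {m : ℕ} (j : Fin (m + 1)) (τ : Equiv.Perm (Fin m)) (i : Fin m) :
    consPerm j τ i.succ = j.succAbove (τ i) := by
  have h : finSuccEquiv' (0 : Fin (m + 1)) i.succ = some i := by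
    rw [← Fin.zero_succAbove, finSuccEquiv'_succAbove]
  simp [consPerm, h]

lemma consPerm_bijective (m : ℕ) :
    Function.Bijective fun p : Fin (m + 1) × Equiv.Perm (Fin m) => consPerm p.1 p.2 := by
  rw [Fintype.bijective_iff_injective_and_card]
  refine ⟨?_, by simp [Fintype.card_perm, Nat.factorial_succ]⟩
  rintro ⟨j, τ⟩ ⟨j', τ'⟩ h
  obtain rfl : j = j' := by simpa using DFunLike.congr_fun h 0
  refine Prod.ext rfl (Equiv.ext fun i => ?_)
  simpa using DFunLike.congr_fun h i.succ

lemma invCount_eq_sum {m : ℕ} (σ : Equiv.Perm (Fin m)) :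
    invCount σ = ∑ a, ∑ b, if a < b ∧ σ b < σ a then 1 else 0 := by
  rw [invCount, Finset.card_filter, Fintype.sum_prod_type]

lemma invCount_consPerm {m : ℕ} (j : Fin (m + 1)) (τ : Equiv.Perm (Fin m)) :
    invCount (consPerm j τ) = j + invCount τ := by
  have h : (∑ b : Fin m, if j.succAbove (τ b) < j then 1 else 0) = (j : ℕ) := by
    rw [Equiv.sum_comp τ fun b => if j.succAbove b < j then 1 else 0, ← Finset.card_filter]
    simp only [Fin.succAbove_lt_iff_castSucc_lt]
    simp only [Fin.lt_def, Fin.val_castSucc]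
    rw [Fin.card_filter_val_lt]
    exact min_eq_right (Nat.lt_succ_iff.1 j.2)
  simp only [invCount_eq_sum, Fin.sum_univ_succ, consPerm_zero, consPerm_succ,
    Fin.succ_lt_succ_iff, Fin.succ_pos, Fin.not_lt_zero, Fin.succAbove_lt_succAbove_iff,
    false_and, true_and, if_false, zero_add, h]

/-- The inverse of a permutation, conjugated by the order reversal. -/
def revInvPerm (m : ℕ) : Equiv.Perm (Fin m) ≃ Equiv.Perm (Fin m) where
  toFun σ := Fin.revPerm.trans (σ.symm.trans Fin.revPerm)
  invFun σ := Fin.revPerm.trans (σ.symm.trans Fin.revPerm)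
  left_inv σ := by ext; simp
  right_inv σ := by ext; simp

@[simp]
lemma revInvPerm_apply {m : ℕ} (σ : Equiv.Perm (Fin m)) (i : Fin m) :
    revInvPerm m σ i = (σ.symm i.rev).rev := rfl

lemma invCount_revInvPerm {m : ℕ} (σ : Equiv.Perm (Fin m)) :
    invCount (revInvPerm m σ) = invCount σ := by
  symm
  refine Finset.card_equiv ((σ.prodCongr σ).trans (Fin.revPerm.prodCongr Fin.revPerm)) ?_
  rintro ⟨a, b⟩
  simp [and_comm]

end Permutations

/-- Two rearrangements of a product agree if the factors in inverted position commute. -/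
lemma List.Perm.prod_map_eq_of_commute {α M : Type*} [Monoid M] {R S : α → α → Prop} {f : α → M}
    (hf : ∀ u v, R u v → S v u → Commute (f u) (f v)) {l₁ l₂ : List α} (h : l₁.Perm l₂)
    (h₁ : l₁.Pairwise R) (h₂ : l₂.Pairwise S) : (l₁.map f).prod = (l₂.map f).prod := by
  induction l₂ generalizing l₁ with
  | nil => rw [h.eq_nil]
  | cons v t ih =>
    obtain ⟨s, s', rfl⟩ := List.append_of_mem (h.mem_iff.2 List.mem_cons_self)
    have hp : (s ++ s').Perm t := (List.perm_middle.symm.trans h).cons_inv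
    have hs : Commute (s.map f).prod (f v) := by
      refine Commute.list_prod_left _ _ fun y hy => ?_
      obtain ⟨u, hu, rfl⟩ := List.mem_map.1 hy
      refine hf u v ?_ ?_
      · exact (List.pairwise_append.1 h₁).2.2 u hu v List.mem_cons_self
      · exact (List.pairwise_cons.1 h₂).1 u (hp.subset (List.mem_append_left _ hu))
    have hss : (s ++ s').Pairwise R :=
      h₁.sublist (List.Sublist.append_left (List.sublist_cons_self _ _) _)
    rw [List.map_cons, List.prod_cons, ← ih hp hss (List.pairwise_cons.1 h₂).2]
    simp only [List.map_append, List.map_cons, List.prod_append, List.prod_cons]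
    rw [← mul_assoc, hs.eq, mul_assoc]

section QDet

variable {k A : Type*} [Field k] [Ring A] [Algebra k A] {q : k}

lemma IsQMatrix.comp {I J I' J' : Type*} [Preorder I] [Preorder J] [Preorder I'] [Preorder J']
    {x : I → J → A} (hx : IsQMatrix q x) {r : I' → I} {c : J' → J} (hr : StrictMono r)
    (hc : StrictMono c) : IsQMatrix q fun i j => x (r i) (c j) where
  row a _ _ h := hx.row (r a) (hc h)
  col c' h := hx.col (c c') (hr h)
  cross₁ hab hcd := hx.cross₁ (hr hab) (hc hcd)
  cross₂ hab hcd := hx.cross₂ (hr hab) (hc hcd)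

/-- Laplace expansion of the quantum determinant along the first row. -/
lemma qDet_succ {m : ℕ} (x : Fin (m + 1) → Fin (m + 1) → A) :
    qDet q x = ∑ j : Fin (m + 1),
      (-q) ^ (j : ℕ) • (x 0 j * qDet q fun a b => x a.succ (j.succAbove b)) := by
  rw [qDet, ← (consPerm_bijective m).sum_comp, Fintype.sum_prod_type]
  refine Finset.sum_congr rfl fun j _ => ?_
  simp only [qDet, Finset.mul_sum, Finset.smul_sum]
  refine Finset.sum_congr rfl fun τ _ => ?_
  simp [invCount_consPerm, List.ofFn_succ, pow_add, mul_smul]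

lemma qDet_cons {m : ℕ} (u : Fin (m + 1) → A) (w : Fin m → Fin (m + 1) → A) :
    qDet q (Fin.cons u w : Fin (m + 1) → Fin (m + 1) → A) = ∑ j : Fin (m + 1),
      (-q) ^ (j : ℕ) • (u j * qDet q fun a b => w a (j.succAbove b)) := by
  simp [qDet_succ]

/-- Simultaneous Laplace expansion along the first two rows. -/
lemma qDet_cons_cons {m : ℕ} (u v : Fin (m + 2) → A) (w : Fin m → Fin (m + 2) → A) :
    qDet q (Fin.cons u (Fin.cons v w) : Fin (m + 2) → Fin (m + 2) → A) =
      ∑ i : Fin (m + 1), ∑ j ∈ Finset.Ici i, (-q) ^ (i + j : ℕ) •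
        ((u i.castSucc * v j.succ - q • (u j.succ * v i.castSucc)) *
          qDet q fun a b => w a (i.castSucc.succAbove (j.succAbove b))) := by
  have h (j : Fin (m + 2)) : (fun a b => (Fin.cons v w : Fin (m + 1) → Fin (m + 2) → A) a
      (j.succAbove b)) = Fin.cons (fun b => v (j.succAbove b)) fun a b => w a (j.succAbove b) := by
    funext a b
    cases a using Fin.cases <;> rfl
  simp only [qDet_cons, h, Finset.mul_sum, Finset.smul_sum]
  rw [Fin.sum_sum_eq_sum_triangle_add]
  refine Finset.sum_congr rfl fun i _ => Finset.sum_congr rfl fun j hj => ?_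
  have hij : i ≤ j := Finset.mem_Ici.1 hj
  have h₁ : i.castSucc.succAbove j = j.succ := Fin.succAbove_of_le_castSucc _ _ hij
  have h₂ : j.succ.succAbove i = i.castSucc := Fin.succAbove_of_castSucc_lt _ _
    (Fin.castSucc_lt_succ_iff.2 hij)
  have h₃ (b : Fin m) : j.succ.succAbove (i.succAbove b) =
      i.castSucc.succAbove (j.succAbove b) := by
    have := Fin.succAbove_succAbove_succAbove_predAbove i.castSucc j b
    rwa [h₁, Fin.predAbove_castSucc_of_le _ _ hij] at this
  simp only [h₁, h₂, h₃, Fin.val_castSucc, Fin.val_succ, sub_mul, smul_mul_assoc,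
    mul_smul_comm, mul_assoc]
  module

/-- The `2 × 2` minors on rows `u`, `v` scale by `-q` when the rows are exchanged. -/
def QSwap {n : ℕ} (q : k) (u v : Fin n → A) : Prop :=
  ∀ c d, c < d → v c * u d - q • (v d * u c) = -q • (u c * v d - q • (u d * v c))

lemma IsQMatrix.qSwap {I : Type*} [LinearOrder I] {n : ℕ} {x : I → Fin n → A} (hq : q ≠ 0)
    (hx : IsQMatrix q x) {a b : I} (hab : a < b) : QSwap q (x a) (x b) := by
  intro c d hcd
  rw [hx.cross₁ hab hcd, hx.cross₂ hab hcd]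
  simp only [smul_sub, smul_add, smul_smul]
  have : -q * (q - q⁻¹) = 1 - q * q := by field_simp; ring
  rw [this]
  module

lemma qDet_cons_cons_of_qSwap {m : ℕ} {u v : Fin (m + 2) → A} (h : QSwap q u v)
    (w : Fin m → Fin (m + 2) → A) :
    qDet q (Fin.cons v (Fin.cons u w) : Fin (m + 2) → Fin (m + 2) → A) =
      -q • qDet q (Fin.cons u (Fin.cons v w) : Fin (m + 2) → Fin (m + 2) → A) := by
  simp only [qDet_cons_cons, Finset.smul_sum]
  refine Finset.sum_congr rfl fun i _ => Finset.sum_congr rfl fun j hj => ?_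
  rw [h _ _ (Fin.castSucc_lt_succ_iff.2 (Finset.mem_Ici.1 hj)), smul_mul_assoc, smul_comm]

lemma qDet_cons_cons_self {m : ℕ} {u : Fin (m + 2) → A}
    (h : ∀ c d, c < d → u c * u d = q • (u d * u c)) (w : Fin m → Fin (m + 2) → A) :
    qDet q (Fin.cons u (Fin.cons u w) : Fin (m + 2) → Fin (m + 2) → A) = 0 := by
  rw [qDet_cons_cons]
  refine Finset.sum_eq_zero fun i _ => Finset.sum_eq_zero fun j hj => ?_
  rw [h _ _ (Fin.castSucc_lt_succ_iff.2 (Finset.mem_Ici.1 hj)), sub_self, zero_mul, smul_zero]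

/-- Moving row `a` to the front multiplies the quantum determinant by `(-q) ^ a`. -/
lemma qDet_cons_removeNth (hq : q ≠ 0) {m : ℕ} {x : Fin (m + 1) → Fin (m + 1) → A}
    (hx : IsQMatrix q x) (a : Fin (m + 1)) :
    qDet q (Fin.cons (x a) fun i => x (a.succAbove i) : Fin (m + 1) → Fin (m + 1) → A) =
      (-q) ^ (a : ℕ) • qDet q x := by
  induction m with
  | zero =>
    obtain rfl := Fin.fin_one_eq_zero a
    simp only [qDet_succ, Fin.cons_zero, Fin.cons_succ]
    simp
  | succ m ih =>
    cases a using Fin.cases with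
    | zero => simp [qDet_succ]
    | succ a =>
      have h : (fun i => x (a.succ.succAbove i)) =
          Fin.cons (x 0) fun i => x (a.succAbove i).succ := by
        funext i
        cases i using Fin.cases <;> simp
      rw [h, qDet_cons_cons_of_qSwap (hx.qSwap hq a.succ_pos), qDet_cons, qDet_succ x,
        Finset.smul_sum, Finset.smul_sum]
      refine Finset.sum_congr rfl fun j _ => ?_
      have h' := ih (hx.comp (Fin.strictMono_succ) (Fin.strictMono_succAbove j)) a
      have h'' : (fun i b => (Fin.cons (x a.succ) (fun i => x (a.succAbove i).succ) :
          Fin (m + 1) → Fin (m + 2) → A) i (j.succAbove b)) =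
          Fin.cons (fun b => x a.succ (j.succAbove b))
            fun i b => x (a.succAbove i).succ (j.succAbove b) := by
        funext i b
        cases i using Fin.cases <;> rfl
      rw [h'', h', mul_smul_comm, smul_smul, smul_smul, smul_smul, Fin.val_succ]
      congr 1
      ring

/-- A quantum determinant with a repeated row, moved to the front, vanishes. -/
lemma qDet_cons_eq_zero (hq : q ≠ 0) {m : ℕ} {x : Fin m → Fin (m + 1) → A}
    (hx : IsQMatrix q x) (a : Fin m) :
    qDet q (Fin.cons (x a) x : Fin (m + 1) → Fin (m + 1) → A) = 0 := by
  induction m with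
  | zero => exact a.elim0
  | succ m ih =>
    have h : x = Fin.cons (x 0) fun i => x i.succ := by
      funext i
      cases i using Fin.cases <;> rfl
    cases a using Fin.cases with
    | zero =>
      rw [h]
      exact qDet_cons_cons_self (fun c d hcd => hx.row 0 hcd) _
    | succ a =>
      rw [h, Fin.cons_succ, qDet_cons_cons_of_qSwap (hx.qSwap hq a.succ_pos), qDet_cons]
      refine smul_eq_zero_of_right _ (Finset.sum_eq_zero fun j _ => ?_)
      have h' := ih (hx.comp (Fin.strictMono_succ) (Fin.strictMono_succAbove j)) a
      have h'' : (fun i b => (Fin.cons (x a.succ) (fun i => x i.succ) :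
          Fin (m + 1) → Fin (m + 2) → A) i (j.succAbove b)) =
          Fin.cons (fun b => x a.succ (j.succAbove b))
            fun i b => x i.succ (j.succAbove b) := by
        funext i b
        cases i using Fin.cases <;> rfl
      rw [h'', h', mul_zero, smul_zero]

/-- Left row expansions of the quantum determinant. -/
lemma sum_mul_qDet_minor (hq : q ≠ 0) {m : ℕ} {x : Fin (m + 1) → Fin (m + 1) → A}
    (hx : IsQMatrix q x) (a b : Fin (m + 1)) :
    ∑ j : Fin (m + 1), (-q) ^ (j : ℕ) •
      (x a j * qDet q fun i l => x (b.succAbove i) (j.succAbove l)) =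
      if a = b then (-q) ^ (b : ℕ) • qDet q x else 0 := by
  rw [← qDet_cons (x a) fun i => x (b.succAbove i)]
  split_ifs with h
  · rw [h, qDet_cons_removeNth hq hx]
  · obtain ⟨c, rfl⟩ := Fin.exists_succAbove_eq h
    exact qDet_cons_eq_zero hq (hx.comp (Fin.strictMono_succAbove b) strictMono_id) c

open MulOpposite in
/-- The antitranspose of a `q`-generic matrix is `q`-generic over the opposite algebra. -/
lemma IsQMatrix.antitranspose {m : ℕ} {x : Fin m → Fin m → A} (hx : IsQMatrix q x) :
    IsQMatrix q fun i j : Fin m => op (x j.rev i.rev) where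
  row a c d h := by
    simp only [← op_mul, ← op_smul]
    rw [hx.col a.rev (Fin.rev_lt_rev.2 h)]
  col c h := by
    simp only [← op_mul, ← op_smul]
    rw [hx.row c.rev (Fin.rev_lt_rev.2 h)]
  cross₁ {a b c d} h h' := by
    simp only [← op_mul, ← op_smul, ← op_add]
    rw [hx.cross₁ (Fin.rev_lt_rev.2 h') (Fin.rev_lt_rev.2 h),
      hx.cross₂ (Fin.rev_lt_rev.2 h') (Fin.rev_lt_rev.2 h)]
  cross₂ h h' := by
    simp only [← op_mul]
    rw [hx.cross₂ (Fin.rev_lt_rev.2 h') (Fin.rev_lt_rev.2 h)]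

open MulOpposite in
lemma qDet_antitranspose {m : ℕ} {x : Fin m → Fin m → A} (hx : IsQMatrix q x) :
    qDet q (fun i j => op (x j.rev i.rev)) = op (qDet q x) := by
  rw [qDet, qDet, Finset.op_sum,
    ← (revInvPerm m).sum_comp fun σ => op ((-q) ^ invCount σ • (List.ofFn fun i => x i (σ i)).prod)]
  refine Finset.sum_congr rfl fun σ _ => ?_
  rw [invCount_revInvPerm, op_smul]
  congr 1
  rw [← unop_inj, unop_list_prod, unop_op]
  have h : ((List.ofFn fun i => ((σ i).rev, i.rev)).reverse.map fun p => x p.1 p.2).prod =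
      ((List.ofFn fun i => (i, revInvPerm m σ i)).map fun p => x p.1 p.2).prod := by
    refine List.Perm.prod_map_eq_of_commute (R := fun u v => u.2 < v.2)
      (S := fun u v => u.1 < v.1) ?_ ?_ ?_ ?_
    · exact fun u v h h' => (hx.cross₂ h' h).symm
    · refine (List.perm_ext_iff_of_nodup ?_ ?_).2 ?_
      · rw [List.nodup_reverse, List.nodup_ofFn]
        exact fun i j h => Fin.rev_injective (congrArg Prod.snd h)
      · rw [List.nodup_ofFn]
        exact fun i j h => congrArg Prod.fst h
      · rintro ⟨a, b⟩
        simp only [List.mem_reverse, List.mem_ofFn, revInvPerm_apply, Prod.mk.injEq]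
        constructor
        · rintro ⟨i, rfl, rfl⟩
          exact ⟨_, rfl, by simp⟩
        · rintro ⟨i, rfl, rfl⟩
          exact ⟨σ.symm i.rev, by simp⟩
    · rw [List.pairwise_reverse, List.pairwise_ofFn]
      exact fun i j h => Fin.rev_lt_rev.2 h
    · rw [List.pairwise_ofFn]
      exact fun i j h => h
  simpa [List.map_ofFn, Function.comp_def] using h

/-- Right column expansions of the quantum determinant. -/
lemma sum_qDet_minor_mul (hq : q ≠ 0) {m : ℕ} {x : Fin (m + 1) → Fin (m + 1) → A}
    (hx : IsQMatrix q x) (a b : Fin (m + 1)) :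
    ∑ j : Fin (m + 1), (-q) ^ (j.rev : ℕ) •
      ((qDet q fun i l => x (j.succAbove i) (b.succAbove l)) * x j a) =
      if a = b then (-q) ^ (b.rev : ℕ) • qDet q x else 0 := by
  have h := sum_mul_qDet_minor hq hx.antitranspose a.rev b.rev
  rw [qDet_antitranspose hx] at h
  apply MulOpposite.op_injective
  rw [Finset.op_sum, ← Equiv.sum_comp Fin.revPerm, apply_ite MulOpposite.op,
    MulOpposite.op_smul, MulOpposite.op_zero]
  simp only [Fin.rev_inj] at h
  rw [← h]
  refine Finset.sum_congr rfl fun j _ => ?_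
  have h' := qDet_antitranspose
    (hx.comp (Fin.strictMono_succAbove j.rev) (Fin.strictMono_succAbove b))
  simp only [← h', Fin.rev_succAbove, Fin.rev_rev, Fin.revPerm_apply, MulOpposite.op_smul,
    MulOpposite.op_mul]

/-- The quantum determinant of a `q`-generic matrix commutes with its entries. -/
theorem IsQMatrix.commute_qDet (hq : q ≠ 0) {m : ℕ} {x : Fin m → Fin m → A}
    (hx : IsQMatrix q x) (a b : Fin m) : Commute (x a b) (qDet q x) := by
  cases m with
  | zero => exact a.elim0
  | succ m =>
    have hL := sum_mul_qDet_minor hq hx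
    have hR := sum_qDet_minor_mul hq hx
    have hpow (c : Fin (m + 1)) : (-q) ^ (c.rev : ℕ) * (-q) ^ (c : ℕ) = (-q) ^ m := by
      rw [← pow_add, Fin.val_rev]
      congr 1
      omega
    let X : Matrix (Fin (m + 1)) (Fin (m + 1)) A := x
    let S : Matrix (Fin (m + 1)) (Fin (m + 1)) A := fun j i =>
      ((-q) ^ (i.rev : ℕ) * (-q) ^ (j : ℕ)) •
        qDet q fun i' l => x (i.succAbove i') (j.succAbove l)
    have hXS : X * S = Matrix.diagonal fun _ => (-q) ^ m • qDet q x := by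
      ext i c
      rw [Matrix.mul_apply, Matrix.diagonal_apply]
      simp only [X, S, mul_smul_comm, mul_smul, ← Finset.smul_sum, hL]
      split_ifs
      · rw [smul_smul, hpow]
      · rw [smul_zero]
    have hSX : S * X = Matrix.diagonal fun _ => (-q) ^ m • qDet q x := by
      ext i c
      rw [Matrix.mul_apply, Matrix.diagonal_apply]
      simp only [X, S, smul_mul_assoc, mul_comm ((-q) ^ (Fin.val (Fin.rev _))), mul_smul,
        ← Finset.smul_sum, hR]
      by_cases h : i = c
      · rw [if_pos h.symm, if_pos h, smul_smul, h, mul_comm, hpow]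
      · rw [if_neg (Ne.symm h), if_neg h, smul_zero]
    have h : X * (S * X) = X * S * X := (mul_assoc _ _ _).symm
    rw [hXS, hSX] at h
    have hab := congrFun (congrFun h a) b
    rw [Matrix.mul_diagonal, Matrix.diagonal_mul, mul_smul_comm, smul_mul_assoc] at hab
    exact (smul_right_injective A (pow_ne_zero m (neg_ne_zero.2 hq))) hab

end QDet

/-- The generators of `M_q(n)` form a `q`-generic matrix. -/
lemma isQMatrix_tgen {k : Type*} [Field k] (q : k) (n : ℕ) : IsQMatrix q (tgen q n) where
  row a _ _ h := by
    simpa [tgen] using RingQuot.mkAlgHom_rel k (QMatRel.row (q := q) a h)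
  col c h := by
    simpa [tgen] using RingQuot.mkAlgHom_rel k (QMatRel.col (q := q) c h)
  cross₁ hab hcd := by
    simpa [tgen] using RingQuot.mkAlgHom_rel k (QMatRel.cross1 (q := q) hab hcd)
  cross₂ hab hcd := by
    simpa [tgen] using RingQuot.mkAlgHom_rel k (QMatRel.cross2 (k := k) (q := q) hab hcd)

/-- Lemma 3 (i): the quantum minor `D^K_L` commutes with every generator
`t^k_l` with `k ∈ K`, `l ∈ L`. -/
theorem qMinor_commutes_inner {k : Type*} [Field k] (q : k) (hq : q ≠ 0)
    {n : ℕ} (m : ℕ) (K L : Finset (Fin n)) (hK : K.card = m) (hL : L.card = m)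
    (i j : Fin n) (hi : i ∈ K) (hj : j ∈ L) :
    tgen q n i j * qMinor q m K L hK hL = qMinor q m K L hK hL * tgen q n i j := by
  have h := ((isQMatrix_tgen q n).comp (K.orderEmbOfFin hK).strictMono
    (L.orderEmbOfFin hL).strictMono).commute_qDet hq
    ((K.orderIsoOfFin hK).symm ⟨i, hi⟩) ((L.orderIsoOfFin hL).symm ⟨j, hj⟩)
  simp only [← Finset.coe_orderIsoOfFin_apply, OrderIso.apply_symm_apply] at h
  exact h
end

section
/- In M_q(n), let K, L ⊆ {1,...,n} with |K| = |L| = m. If k > max K and l ∈ L, or l > max L and k ∈ K, then t^k_l D^K_L = q⁻¹ D^K_L t^k_l. If k < min K and l ∈ L, or l < min L and k ∈ K, then t^k_l D^K_L = q D^K_L t^k_l. -/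
open scoped BigOperators

section QuantumMinor

variable {k A α β : Type*} [Field k] [Ring A] [Algebra k A] [LinearOrder β]

/-- The quantum minor with a list of rows and a set of columns, by iterated Laplace
expansion along the first row. -/
def laplaceMinor (q : k) (t : α → β → A) : List α → Finset β → A
  | [], _ => 1
  | a :: r, L => ∑ l ∈ L, (-q) ^ (L.filter (· < l)).card • (t a l * laplaceMinor q t r (L.erase l))

theorem laplaceMinor_cons (q : k) (t : α → β → A) (a : α) (r : List α) (L : Finset β) :
    laplaceMinor q t (a :: r) L = ∑ l ∈ L, (-q) ^ (L.filter (· < l)).card •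
      (t a l * laplaceMinor q t r (L.erase l)) := rfl

theorem card_filter_lt_erase_of_le {L : Finset β} {x y : β} (h : x ≤ y) :
    ((L.erase y).filter (· < x)).card = (L.filter (· < x)).card := by
  rw [Finset.filter_erase, Finset.erase_eq_of_notMem]
  simp [h]

theorem card_filter_lt_erase_of_lt {L : Finset β} {x y : β} (hx : x ∈ L) (h : x < y) :
    ((L.erase x).filter (· < y)).card + 1 = (L.filter (· < y)).card := by
  rw [Finset.filter_erase, Finset.card_erase_add_one]
  simp [h, hx]

theorem sum_sum_erase_eq_sum_sum_lt (L : Finset β) (H : β → β → A) :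
    ∑ x ∈ L, ∑ y ∈ L.erase x, H x y =
      ∑ x ∈ L, ∑ y ∈ L.filter (x < ·), (H x y + H y x) := by
  have h : ∀ x ∈ L, ∑ y ∈ L.erase x, H x y =
      ∑ y ∈ L.filter (x < ·), H x y + ∑ y ∈ L.filter (· < x), H x y := by
    intro x _
    rw [← Finset.sum_union]
    · congr 1
      ext y
      simp only [Finset.mem_erase, Finset.mem_union, Finset.mem_filter, ne_iff_lt_or_gt]
      tauto
    · rw [Finset.disjoint_filter]
      intro y _ h1 h2
      exact lt_asymm h1 h2
  simp only [Finset.sum_congr rfl h, Finset.sum_add_distrib]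
  congr 1
  apply Finset.sum_comm'
  simp
  tauto

theorem laplaceMinor_cons_cons (q : k) (t : α → β → A) (a b : α) (r : List α) (L : Finset β) :
    laplaceMinor q t (a :: b :: r) L =
      ∑ x ∈ L, ∑ y ∈ L.filter (x < ·),
        (-q) ^ ((L.filter (· < x)).card + ((L.erase x).filter (· < y)).card) •
          ((t a x * t b y - q • (t a y * t b x)) *
            laplaceMinor q t r ((L.erase x).erase y)) := by
  have h := sum_sum_erase_eq_sum_sum_lt L (fun x y =>
    (-q) ^ ((L.filter (· < x)).card + ((L.erase x).filter (· < y)).card) •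
      (t a x * t b y * laplaceMinor q t r ((L.erase x).erase y)))
  simp only [laplaceMinor_cons, Finset.mul_sum, Finset.smul_sum]
  refine Eq.trans ?_ (h.trans ?_)
  · refine Finset.sum_congr rfl fun x _ => Finset.sum_congr rfl fun y _ => ?_
    rw [pow_add, mul_smul, mul_smul_comm, mul_assoc]
  · refine Finset.sum_congr rfl fun x hx => Finset.sum_congr rfl fun y hy => ?_
    obtain ⟨hy, hxy⟩ := Finset.mem_filter.1 hy
    rw [card_filter_lt_erase_of_le hxy.le, ← card_filter_lt_erase_of_lt hx hxy,
      Finset.erase_right_comm (a := y),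
      show ((L.erase x).filter (· < y)).card + 1 + (L.filter (· < x)).card =
        (L.filter (· < x)).card + ((L.erase x).filter (· < y)).card + 1 by omega,
      pow_succ, mul_smul, ← smul_add, sub_mul, smul_mul_assoc, neg_smul, sub_eq_add_neg]

theorem laplaceMinor_insert (q : k) (t : α → β → A) {l₀ : β} {L : Finset β} (hL : ∀ l ∈ L, l₀ < l)
    (a : α) (r : List α) :
    laplaceMinor q t (a :: r) (insert l₀ L) = t a l₀ * laplaceMinor q t r L +
      ∑ l ∈ L, (-q) ^ ((L.filter (· < l)).card + 1) •
        (t a l * laplaceMinor q t r (insert l₀ (L.erase l))) := by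
  have h₀ : l₀ ∉ L := fun h => lt_irrefl _ (hL _ h)
  rw [laplaceMinor_cons, Finset.sum_insert h₀]
  congr 1
  · rw [Finset.filter_false_of_mem, Finset.erase_insert h₀]
    · simp
    · simpa using fun l hl => (hL l hl).le
  · refine Finset.sum_congr rfl fun l hl => ?_
    rw [Finset.filter_insert, if_pos (hL l hl), Finset.card_insert_of_notMem (by simp [h₀]),
      Finset.erase_insert_of_ne (hL l hl).ne]

/-- The permutation sending `0` to `p` whose remaining values are those of `τ`, shifted past `p`. -/
def Equiv.Perm.consAbove {m : ℕ} (p : Fin (m + 1)) (τ : Equiv.Perm (Fin m)) :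
    Equiv.Perm (Fin (m + 1)) :=
  (Equiv.Perm.decomposeFin.symm (0, τ)).trans p.cycleRange.symm

namespace Equiv.Perm

theorem consAbove_zero {m : ℕ} (p : Fin (m + 1)) (τ : Equiv.Perm (Fin m)) :
    consAbove p τ 0 = p := by
  simp [consAbove]

theorem consAbove_succ {m : ℕ} (p : Fin (m + 1)) (τ : Equiv.Perm (Fin m)) (i : Fin m) :
    consAbove p τ i.succ = p.succAbove (τ i) := by
  simp [consAbove]

theorem consAbove_bijective (m : ℕ) :
    Function.Bijective (fun x : Fin (m + 1) × Equiv.Perm (Fin m) => consAbove x.1 x.2) := by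
  rw [Fintype.bijective_iff_injective_and_card]
  refine ⟨?_, by simp [Fintype.card_perm, Nat.factorial_succ]⟩
  rintro ⟨p, τ⟩ ⟨p', τ'⟩ h
  have hp : p = p' := by simpa [consAbove_zero] using Equiv.congr_fun h 0
  subst hp
  have hτ : τ = τ' := by
    ext1 i
    simpa [consAbove_succ] using Equiv.congr_fun h i.succ
  rw [hτ]

end Equiv.Perm

theorem invCount_consAbove {m : ℕ} (p : Fin (m + 1)) (τ : Equiv.Perm (Fin m)) :
    invCount (Equiv.Perm.consAbove p τ) = p + invCount τ := by
  have h0 : (Finset.univ.filter fun j : Fin m => p.succAbove (τ j) < p).card = p := by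
    have hsub : Finset.univ.filter (fun j : Fin m => p.succAbove j < p) =
        Finset.univ.filter (fun j : Fin m => (j : ℕ) < p) := by
      ext j
      rw [Finset.mem_filter_univ, Finset.mem_filter_univ, Fin.succAbove_lt_iff_castSucc_lt,
        Fin.lt_def, Fin.val_castSucc]
    calc _ = (Finset.univ.filter fun j : Fin m => p.succAbove j < p).card :=
          Finset.card_equiv τ (by simp)
      _ = p := by
        rw [hsub, Fin.card_filter_val_lt]
        omega
  simp only [invCount, Finset.card_filter, Fintype.sum_prod_type, Fin.sum_univ_succ,
    Equiv.Perm.consAbove_zero, Equiv.Perm.consAbove_succ] at h0 ⊢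
  simp [h0]

theorem sum_perm_eq_laplaceMinor (q : k) (t : α → β → A) {m : ℕ} (r : Fin m → α)
    (c : Fin m ↪o β) :
    ∑ σ : Equiv.Perm (Fin m), (-q) ^ invCount σ •
        (List.ofFn fun i => t (r i) (c (σ i))).prod =
      laplaceMinor q t (List.ofFn r) (Finset.univ.map c.toEmbedding) := by
  induction m with
  | zero => simp [laplaceMinor, invCount]
  | succ m ih =>
    rw [← (Equiv.Perm.consAbove_bijective m).sum_comp, Fintype.sum_prod_type, List.ofFn_succ,
      laplaceMinor_cons, Finset.sum_map]
    refine Finset.sum_congr rfl fun p _ => ?_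
    have hcard : ((Finset.univ.map c.toEmbedding).filter (· < c p)).card = (p : ℕ) := by
      rw [Finset.filter_map, Finset.card_map]
      simp [Finset.filter_gt_eq_Iio]
    have herase : (Finset.univ.map c.toEmbedding).erase (c p) =
        Finset.univ.map ((Fin.succAboveOrderEmb p).trans c).toEmbedding := by
      ext x
      simp only [Finset.mem_erase, Finset.mem_map, Finset.mem_univ, true_and]
      constructor
      · rintro ⟨hx, j, rfl⟩
        obtain ⟨i, rfl⟩ := Fin.exists_succAbove_eq (x := j) (y := p) (fun h => hx (by simp [h]))
        exact ⟨i, rfl⟩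
      · rintro ⟨i, rfl⟩
        exact ⟨by simp, p.succAbove i, rfl⟩
    simp only [RelEmbedding.coe_toEmbedding]
    rw [hcard, herase, ← ih, Finset.mul_sum, Finset.smul_sum]
    refine Finset.sum_congr rfl fun τ _ => ?_
    simp [invCount_consAbove, List.ofFn_succ, Equiv.Perm.consAbove_zero,
      Equiv.Perm.consAbove_succ, pow_add, mul_smul]

variable [LinearOrder α]

/-- The family `t` satisfies the relations of the quantum matrix bialgebra. -/
structure IsQuantumMatrix (q : k) (t : α → β → A) : Prop where
  row : ∀ a {c d}, c < d → t a c * t a d = q • (t a d * t a c)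
  col : ∀ {a b} c, a < b → t a c * t b c = q • (t b c * t a c)
  cross : ∀ {a b c d}, a < b → c < d →
    t a c * t b d = t b d * t a c + (q - q⁻¹) • (t b c * t a d)
  comm : ∀ {a b c d}, a < b → d < c → t a c * t b d = t b d * t a c

variable {q : k} {t : α → β → A}

namespace IsQuantumMatrix

theorem transpose (h : IsQuantumMatrix q t) : IsQuantumMatrix q (fun b a => t a b) where
  row a _ _ hcd := h.col a hcd
  col c hab := h.row c hab
  cross hab hcd := by rw [h.cross hcd hab, h.comm hcd hab]
  comm hab hdc := (h.comm hdc hab).symm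

theorem cross_rev (h : IsQuantumMatrix q t) {a b : α} {c d : β} (hab : a < b) (hcd : c < d) :
    t b d * t a c = t a c * t b d - (q - q⁻¹) • (t a d * t b c) := by
  rw [h.cross hab hcd, h.comm hab hcd, add_sub_cancel_right]

theorem laplaceMinor_self (h : IsQuantumMatrix q t) (a : α) (r : List α) (L : Finset β) :
    laplaceMinor q t (a :: a :: r) L = 0 := by
  rw [laplaceMinor_cons_cons]
  refine Finset.sum_eq_zero fun x _ => Finset.sum_eq_zero fun y hy => ?_
  rw [h.row a (Finset.mem_filter.1 hy).2, sub_self, zero_mul, smul_zero]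

theorem laplaceMinor_swap (h : IsQuantumMatrix q t) (hq : q ≠ 0) {a b : α} (hab : a < b)
    (r : List α) (L : Finset β) :
    laplaceMinor q t (b :: a :: r) L = (-q) • laplaceMinor q t (a :: b :: r) L := by
  simp only [laplaceMinor_cons_cons, Finset.smul_sum]
  refine Finset.sum_congr rfl fun x _ => Finset.sum_congr rfl fun y hy => ?_
  have hxy := (Finset.mem_filter.1 hy).2
  rw [smul_comm (-q), ← smul_mul_assoc (-q)]
  congr 2
  rw [h.cross_rev hab hxy, ← h.comm hab hxy, smul_sub, smul_smul, smul_sub, smul_smul, mul_sub,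
    mul_inv_cancel₀ hq]
  module

theorem laplaceMinor_cons_eq_zero (h : IsQuantumMatrix q t) (hq : q ≠ 0) {a : α} {r : List α}
    (hr : r.Pairwise (· < ·)) (ha : a ∈ r) (L : Finset β) :
    laplaceMinor q t (a :: r) L = 0 := by
  induction r generalizing L with
  | nil => simp at ha
  | cons b r ih =>
    obtain ⟨hb, hr⟩ := List.pairwise_cons.1 hr
    rcases List.mem_cons.1 ha with rfl | ha
    · exact h.laplaceMinor_self _ _ _
    · rw [h.laplaceMinor_swap hq (hb a ha), laplaceMinor_cons]
      simp [ih hr ha]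

theorem mul_laplaceMinor_of_forall_lt (h : IsQuantumMatrix q t) {a : α} {b : β} {r : List α}
    (hr : ∀ i ∈ r, a < i) {L : Finset β} (hL : ∀ j ∈ L, j < b) :
    t a b * laplaceMinor q t r L = laplaceMinor q t r L * t a b := by
  induction r generalizing L with
  | nil => simp [laplaceMinor]
  | cons c r ih =>
    rw [laplaceMinor_cons, Finset.mul_sum, Finset.sum_mul]
    refine Finset.sum_congr rfl fun l hl => ?_
    rw [mul_smul_comm, ← mul_assoc, h.comm (hr c (by simp)) (hL l hl), mul_assoc,
      ih (fun i hi => hr i (by simp [hi])) (fun j hj => hL j (Finset.mem_of_mem_erase hj)),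
      smul_mul_assoc, mul_assoc]

theorem mul_laplaceMinor_of_gt (h : IsQuantumMatrix q t) (hq : q ≠ 0) {a : α} {b : β} {r : List α}
    (hr : r.Pairwise (· < ·)) (ha : a ∈ r) {L : Finset β} (hL : ∀ j ∈ L, j < b) :
    t a b * laplaceMinor q t r L = q⁻¹ • (laplaceMinor q t r L * t a b) := by
  induction r generalizing L with
  | nil => simp at ha
  | cons c r ih =>
    obtain ⟨hc, hr⟩ := List.pairwise_cons.1 hr
    have hL' : ∀ l, ∀ j ∈ L.erase l, j < b := fun l j hj => hL j (Finset.mem_of_mem_erase hj)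
    rcases List.mem_cons.1 ha with rfl | ha
    · rw [laplaceMinor_cons, Finset.mul_sum, Finset.sum_mul, Finset.smul_sum]
      refine Finset.sum_congr rfl fun l hl => ?_
      rw [smul_mul_assoc, mul_assoc, ← h.mul_laplaceMinor_of_forall_lt hc (hL' l), ← mul_assoc,
        h.row a (hL l hl), mul_smul_comm, smul_mul_assoc, smul_comm q⁻¹, inv_smul_smul₀ hq,
        mul_assoc]
    · have hz := h.laplaceMinor_cons_eq_zero hq hr ha L
      have key : t a b * laplaceMinor q t (c :: r) L =
          q⁻¹ • (laplaceMinor q t (c :: r) L * t a b) -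
            (q - q⁻¹) • (t c b * laplaceMinor q t (a :: r) L) := by
        simp only [laplaceMinor_cons, Finset.mul_sum, Finset.sum_mul, Finset.smul_sum,
          ← Finset.sum_sub_distrib]
        refine Finset.sum_congr rfl fun l hl => ?_
        rw [mul_smul_comm, ← mul_assoc, h.cross_rev (hc a ha) (hL l hl), sub_mul, mul_assoc,
          ih hr ha (hL' l)]
        simp only [smul_mul_assoc, mul_smul_comm, mul_assoc, smul_sub]
        rw [smul_comm q⁻¹, smul_comm (q - q⁻¹)]
      rw [key, hz, mul_zero, smul_zero, sub_zero]

theorem laplaceMinor_mul_of_forall_lt (h : IsQuantumMatrix q t) (hq : q ≠ 0) {a : α} {b : β}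
    {r : List α} (hr : ∀ i ∈ r, a < i) {L : Finset β} (hL : ∀ j ∈ L, b < j) :
    t a b * laplaceMinor q t (a :: r) L = q • (laplaceMinor q t (a :: r) L * t a b) := by
  induction r generalizing L with
  | nil =>
    simp only [laplaceMinor, Finset.mul_sum, Finset.sum_mul, Finset.smul_sum, mul_one]
    refine Finset.sum_congr rfl fun l hl => ?_
    rw [mul_smul_comm, h.row a (hL l hl), smul_mul_assoc, smul_comm]
  | cons c r ih =>
    have hac : a < c := hr c (by simp)
    have hr' : ∀ i ∈ r, a < i := fun i hi => hr i (by simp [hi])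
    have hL' : ∀ l, ∀ j ∈ L.erase l, b < j := fun l j hj => hL j (Finset.mem_of_mem_erase hj)
    have key : t a b * laplaceMinor q t (c :: a :: r) L =
        q • (laplaceMinor q t (c :: a :: r) L * t a b) +
          (q - q⁻¹) • (t c b * laplaceMinor q t (a :: a :: r) L) := by
      rw [laplaceMinor_cons q t c, laplaceMinor_cons q t a (a :: r)]
      simp only [Finset.mul_sum, Finset.sum_mul, Finset.smul_sum, ← Finset.sum_add_distrib]
      refine Finset.sum_congr rfl fun l hl => ?_
      rw [mul_smul_comm, ← mul_assoc, h.cross hac (hL l hl), add_mul, mul_assoc, ih hr' (hL' l)]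
      simp only [smul_mul_assoc, mul_smul_comm, mul_assoc, smul_add]
      rw [smul_comm q, smul_comm (q - q⁻¹)]
    rw [h.laplaceMinor_self, mul_zero, smul_zero, add_zero, h.laplaceMinor_swap hq hac,
      mul_smul_comm, smul_mul_assoc, smul_comm q] at key
    exact smul_right_injective A (neg_ne_zero.2 hq) key

theorem mul_laplaceMinor_of_lt (h : IsQuantumMatrix q t) (hq : q ≠ 0) {a : α} {b : β} {r : List α}
    (hr : r.Pairwise (· < ·)) (ha : a ∈ r) {L : Finset β} (hL : ∀ j ∈ L, b < j) :
    t a b * laplaceMinor q t r L = q • (laplaceMinor q t r L * t a b) := by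
  induction r generalizing L with
  | nil => simp at ha
  | cons c r ih =>
    obtain ⟨hc, hr⟩ := List.pairwise_cons.1 hr
    rcases List.mem_cons.1 ha with rfl | ha
    · exact h.laplaceMinor_mul_of_forall_lt hq hc hL
    · rw [laplaceMinor_cons, Finset.mul_sum, Finset.sum_mul, Finset.smul_sum]
      refine Finset.sum_congr rfl fun l hl => ?_
      rw [mul_smul_comm, ← mul_assoc, ← h.comm (hc a ha) (hL l hl), mul_assoc,
        ih hr ha (fun j hj => hL j (Finset.mem_of_mem_erase hj))]
      simp only [smul_mul_assoc, mul_smul_comm, mul_assoc]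
      rw [smul_comm q]

end IsQuantumMatrix

theorem List.Nodup.toFinset_erase_eq {l : List β} (h : l.Nodup) (x : β) :
    (l.erase x).toFinset = l.toFinset.erase x := by
  ext y
  simp [h.mem_erase_iff]

theorem IsQuantumMatrix.laplaceMinor_transpose (h : IsQuantumMatrix q t) {r : List α}
    {c : List β} (hr : r.Pairwise (· < ·)) (hc : c.Pairwise (· < ·)) (hrc : r.length = c.length) :
    laplaceMinor q t r c.toFinset = laplaceMinor q (fun b a => t a b) c r.toFinset := by
  induction hm : r.length using Nat.strong_induction_on generalizing r c with
  | _ m ih =>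
  subst hm
  match r, c, hrc with
  | [], [], _ => rfl
  | a :: r, b :: c, hrc =>
    obtain ⟨ha, hr⟩ := List.pairwise_cons.1 hr
    obtain ⟨hb, hc⟩ := List.pairwise_cons.1 hc
    simp only [List.length_cons, add_left_inj] at hrc
    have hrn : r.Nodup := hr.imp ne_of_lt
    have hcn : c.Nodup := hc.imp ne_of_lt
    rw [List.toFinset_cons, List.toFinset_cons, laplaceMinor_insert _ _ (by simpa using hb),
      laplaceMinor_insert _ _ (by simpa using ha), ih r.length (by simp) hr hc hrc rfl]
    congr 1
    have hleft : ∀ l ∈ c.toFinset,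
        laplaceMinor q t r (insert b (c.toFinset.erase l)) =
          ∑ i ∈ r.toFinset, (-q) ^ (r.toFinset.filter (· < i)).card •
            (t i b * laplaceMinor q (fun b a => t a b) (c.erase l) (r.toFinset.erase i)) := by
      intro l hl
      rw [List.mem_toFinset] at hl
      have hpos := List.length_pos_of_mem hl
      rw [← hcn.toFinset_erase_eq, ← List.toFinset_cons, ih r.length (by simp) hr
        (List.pairwise_cons.2 ⟨fun j hj => hb j (List.mem_of_mem_erase hj),
          hc.sublist List.erase_sublist⟩)
        (by rw [List.length_cons, List.length_erase_of_mem hl]; omega) rfl]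
      rfl
    have hright : ∀ i ∈ r.toFinset,
        laplaceMinor q (fun b a => t a b) c (insert a (r.toFinset.erase i)) =
          ∑ l ∈ c.toFinset, (-q) ^ (c.toFinset.filter (· < l)).card •
            (t a l * laplaceMinor q (fun b a => t a b) (c.erase l) (r.toFinset.erase i)) := by
      intro i hi
      rw [List.mem_toFinset] at hi
      have hpos := List.length_pos_of_mem hi
      rw [← hrn.toFinset_erase_eq, ← List.toFinset_cons, ← ih r.length (by simp)
        (List.pairwise_cons.2 ⟨fun j hj => ha j (List.mem_of_mem_erase hj),
          hr.sublist List.erase_sublist⟩) hc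
        (by rw [List.length_cons, List.length_erase_of_mem hi]; omega)
        (by rw [List.length_cons, List.length_erase_of_mem hi]; omega), laplaceMinor_cons]
      refine Finset.sum_congr rfl fun l hl => ?_
      rw [List.mem_toFinset] at hl
      rw [← hcn.toFinset_erase_eq, ih (r.erase i).length
        (by rw [List.length_cons, List.length_erase_of_mem hi]; omega)
        (hr.sublist List.erase_sublist) (hc.sublist List.erase_sublist)
        (by rw [List.length_erase_of_mem hi, List.length_erase_of_mem hl, hrc]) rfl]
    refine (Finset.sum_congr rfl fun l hl => by rw [hleft l hl]).trans
      (Eq.trans ?_ (Finset.sum_congr rfl fun i hi => by rw [hright i hi]).symm)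
    simp only [Finset.mul_sum, Finset.smul_sum]
    rw [Finset.sum_comm]
    refine Finset.sum_congr rfl fun i hi => Finset.sum_congr rfl fun l hl => ?_
    rw [List.mem_toFinset] at hi hl
    simp only [mul_smul_comm, smul_smul, ← mul_assoc]
    rw [h.comm (ha i hi) (hb l hl)]
    congr 1
    ring

end QuantumMinor

theorem isQuantumMatrix_tgen {k : Type*} [Field k] (q : k) (n : ℕ) :
    IsQuantumMatrix q (tgen q n) where
  row a _ _ h := by
    simpa [tgen] using RingQuot.mkAlgHom_rel k (QMatRel.row (q := q) a h)
  col c h := by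
    simpa [tgen] using RingQuot.mkAlgHom_rel k (QMatRel.col (q := q) c h)
  cross h h' := by
    simpa [tgen] using RingQuot.mkAlgHom_rel k (QMatRel.cross1 (q := q) h h')
  comm h h' := by
    simpa [tgen] using RingQuot.mkAlgHom_rel k (QMatRel.cross2 (q := q) h h')

theorem qMinor_eq_laplaceMinor {k : Type*} [Field k] (q : k) {n : ℕ} (m : ℕ)
    (K L : Finset (Fin n)) (hK : K.card = m) (hL : L.card = m) :
    qMinor q m K L hK hL = laplaceMinor q (tgen q n) (K.sort (· ≤ ·)) L := by
  subst hK
  have h := sum_perm_eq_laplaceMinor q (tgen q n) (fun i => K.orderEmbOfFin rfl i)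
    (L.orderEmbOfFin hL)
  have hcols : Finset.univ.map (L.orderEmbOfFin hL).toEmbedding = L := by
    simp
  have hrows : List.ofFn (fun i => K.orderEmbOfFin rfl i) = K.sort (· ≤ ·) := by
    refine List.ext_getElem (by simp) fun i _ _ => ?_
    simp [Finset.orderEmbOfFin_apply]
  rw [hcols, hrows] at h
  exact h

theorem qMinor_eq_laplaceMinor_transpose {k : Type*} [Field k] (q : k) {n : ℕ} (m : ℕ)
    (K L : Finset (Fin n)) (hK : K.card = m) (hL : L.card = m) :
    qMinor q m K L hK hL =
      laplaceMinor q (fun j i => tgen q n i j) (L.sort (· ≤ ·)) K := by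
  have h := (isQuantumMatrix_tgen q n).laplaceMinor_transpose (r := K.sort (· ≤ ·))
    (c := L.sort (· ≤ ·)) (Finset.sortedLT_sort K).pairwise (Finset.sortedLT_sort L).pairwise
    (by simp [hK, hL])
  rwa [Finset.sort_toFinset, Finset.sort_toFinset, ← qMinor_eq_laplaceMinor q m K L hK hL] at h

/-- Lemma 3 (ii), first part: if `k > max K` and `l ∈ L`, or `l > max L` and
`k ∈ K`, then `t^k_l D^K_L = q⁻¹ D^K_L t^k_l`; if `k < min K` and `l ∈ L`, or
`l < min L` and `k ∈ K`, then `t^k_l D^K_L = q D^K_L t^k_l`. -/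
theorem tgen_qMinor_qcommute {k : Type*} [Field k] (q : k) (hq : q ≠ 0)
    {n : ℕ} (m : ℕ) (K L : Finset (Fin n)) (hK : K.card = m) (hL : L.card = m)
    (a b : Fin n) :
    (((∀ i ∈ K, i < a) ∧ b ∈ L) ∨ ((∀ j ∈ L, j < b) ∧ a ∈ K) →
      tgen q n a b * qMinor q m K L hK hL =
        q⁻¹ • (qMinor q m K L hK hL * tgen q n a b)) ∧
    (((∀ i ∈ K, a < i) ∧ b ∈ L) ∨ ((∀ j ∈ L, b < j) ∧ a ∈ K) →
      tgen q n a b * qMinor q m K L hK hL =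
        q • (qMinor q m K L hK hL * tgen q n a b)) := by
  have ht := isQuantumMatrix_tgen q n
  have hrows := (Finset.sortedLT_sort K).pairwise
  have hcols := (Finset.sortedLT_sort L).pairwise
  refine ⟨?_, ?_⟩
  · rintro (⟨ha, hb⟩ | ⟨hb, ha⟩)
    · rw [qMinor_eq_laplaceMinor_transpose]
      exact ht.transpose.mul_laplaceMinor_of_gt hq hcols ((Finset.mem_sort _).2 hb) ha
    · rw [qMinor_eq_laplaceMinor]
      exact ht.mul_laplaceMinor_of_gt hq hrows ((Finset.mem_sort _).2 ha) hb
  · rintro (⟨ha, hb⟩ | ⟨hb, ha⟩)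
    · rw [qMinor_eq_laplaceMinor_transpose]
      exact ht.transpose.mul_laplaceMinor_of_lt hq hcols ((Finset.mem_sort _).2 hb) ha
    · rw [qMinor_eq_laplaceMinor]
      exact ht.mul_laplaceMinor_of_lt hq hrows ((Finset.mem_sort _).2 ha) hb
end

section
/- The quantum matrix algebra M_q(n) has no zero divisors: if a, b ∈ M_q(n) with ab = 0, then a = 0 or b = 0. -/
open scoped BigOperators

/-- A multiplicative bicharacter on an additive monoid, with values in the units of `k`. -/
structure Bicharacter (k G : Type*) [Field k] [AddMonoid G] where
  /-- The underlying function. -/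
  toFun : G → G → kˣ
  add_left : ∀ a b c, toFun (a + b) c = toFun a c * toFun b c
  add_right : ∀ a b c, toFun a (b + c) = toFun a b * toFun a c

namespace Bicharacter

variable {k G : Type*} [Field k] [AddMonoid G] (χ : Bicharacter k G)

instance : CoeFun (Bicharacter k G) fun _ => G → G → kˣ := ⟨toFun⟩

@[simp] lemma zero_left (a : G) : χ 0 a = 1 := by
  have h := χ.add_left 0 0 a
  rw [add_zero] at h
  exact left_eq_mul.mp h

@[simp] lemma zero_right (a : G) : χ a 0 = 1 := by
  have h := χ.add_right a 0 0
  rw [add_zero] at h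
  exact left_eq_mul.mp h

end Bicharacter

/-- The monoid algebra of `G` over `A`, with the product of two monomials twisted by the
bicharacter `χ`. -/
def TwistedAlgebra {k G : Type*} [Field k] [AddMonoid G] (_χ : Bicharacter k G)
    (A : Type*) [Ring A] : Type _ := G →₀ A

namespace TwistedAlgebra

variable {k G A : Type*} [Field k] [AddMonoid G] (χ : Bicharacter k G) [Ring A] [Algebra k A]

noncomputable instance : AddCommGroup (TwistedAlgebra χ A) :=
  inferInstanceAs (AddCommGroup (G →₀ A))

noncomputable instance : Module k (TwistedAlgebra χ A) :=
  inferInstanceAs (Module k (G →₀ A))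

/-- The monomial of degree `g` with coefficient `a`. -/
noncomputable def single (g : G) : A →ₗ[k] TwistedAlgebra χ A := Finsupp.lsingle g

/-- The coefficient in degree `g`. -/
noncomputable def coeff (g : G) : TwistedAlgebra χ A →ₗ[k] A := Finsupp.lapply g

/-- The twisted product as a bilinear map. -/
noncomputable def mulHom :
    TwistedAlgebra χ A →ₗ[k] TwistedAlgebra χ A →ₗ[k] TwistedAlgebra χ A :=
  Finsupp.lsum k fun g => LinearMap.flip (Finsupp.lsum k fun h => LinearMap.flip
    ((LinearMap.mul k A).compr₂ ((χ g h : k) • single χ (g + h))))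

noncomputable instance : Mul (TwistedAlgebra χ A) := ⟨fun x y => mulHom χ x y⟩

noncomputable instance : One (TwistedAlgebra χ A) := ⟨single χ 0 1⟩

lemma one_def : (1 : TwistedAlgebra χ A) = single χ 0 1 := rfl

lemma single_mul_single (g h : G) (a b : A) :
    single χ g a * single χ h b = (χ g h : k) • single χ (g + h) (a * b) := by
  have h₁ : mulHom χ (single χ g a) = LinearMap.flip (Finsupp.lsum k fun h => LinearMap.flip
      ((LinearMap.mul k A).compr₂ ((χ g h : k) • single χ (g + h)))) a :=
    Finsupp.lsum_single k _ g a
  have h₂ : mulHom χ (single χ g a) (single χ h b) =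
      ((LinearMap.mul k A).compr₂ ((χ g h : k) • single χ (g + h))) a b := by
    rw [h₁]
    exact congrArg (fun f : A →ₗ[k] TwistedAlgebra χ A => f a) (Finsupp.lsum_single k _ h b)
  exact h₂

variable {χ} in
lemma induction_single {p : TwistedAlgebra χ A → Prop} (x : TwistedAlgebra χ A)
    (zero : p 0) (add : ∀ x y, p x → p y → p (x + y)) (single : ∀ g a, p (single χ g a)) :
    p x :=
  Finsupp.induction_linear x zero add single

noncomputable instance : Ring (TwistedAlgebra χ A) :=
  { (inferInstance : AddCommGroup (TwistedAlgebra χ A)) with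
    mul := (· * ·)
    one := 1
    left_distrib := fun x y z => map_add (mulHom χ x) y z
    right_distrib := fun x y z => LinearMap.map_add₂ (mulHom χ) x y z
    zero_mul := fun x => LinearMap.map_zero₂ (mulHom χ) x
    mul_zero := fun x => map_zero (mulHom χ x)
    mul_assoc := fun x y z => by
      change mulHom χ (mulHom χ x y) z = mulHom χ x (mulHom χ y z)
      induction x using induction_single with
      | zero => simp
      | add x₁ x₂ h₁ h₂ => simp only [map_add, LinearMap.add_apply, h₁, h₂]
      | single g a =>
        induction y using induction_single with
        | zero => simp
        | add y₁ y₂ h₁ h₂ => simp only [map_add, LinearMap.add_apply, h₁, h₂]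
        | single h b =>
          induction z using induction_single with
          | zero => simp
          | add z₁ z₂ h₁ h₂ => simp only [map_add, h₁, h₂]
          | single l c =>
            have key : ∀ (g h : G) (a b : A), mulHom χ (single χ g a) (single χ h b) =
              (χ g h : k) • single χ (g + h) (a * b) := single_mul_single χ
            simp only [key, map_smul, LinearMap.smul_apply, smul_smul, χ.add_left, χ.add_right,
              Units.val_mul, mul_assoc, add_assoc]
            congr 1
            ring
    one_mul := fun x => by
      change mulHom χ (single χ 0 1) x = x
      induction x using induction_single with
      | zero => simp
      | add x₁ x₂ h₁ h₂ => simp only [map_add, h₁, h₂]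
      | single g a => exact (single_mul_single χ 0 g 1 a).trans (by simp)
    mul_one := fun x => by
      change mulHom χ x (single χ 0 1) = x
      induction x using induction_single with
      | zero => simp
      | add x₁ x₂ h₁ h₂ => simp only [map_add, LinearMap.add_apply, h₁, h₂]
      | single g a => exact (single_mul_single χ g 0 a 1).trans (by simp) }

noncomputable instance : Algebra k (TwistedAlgebra χ A) :=
  Algebra.ofModule (fun r x y => LinearMap.map_smul₂ (mulHom χ) r x y)
    (fun r x y => map_smul (mulHom χ x) r y)

lemma coeff_single [DecidableEq G] (g h : G) (a : A) :
    coeff χ h (single χ g a) = if g = h then a else 0 :=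
  Finsupp.single_apply

lemma coeff_mul_of_uniqueAdd {x y : TwistedAlgebra χ A} {g h : G}
    (H : UniqueAdd (Finsupp.support x) (Finsupp.support y) g h) :
    coeff χ (g + h) (x * y) = (χ g h : k) • (coeff χ g x * coeff χ h y) := by
  classical
  have hx : x = ∑ a ∈ Finsupp.support x, single χ a (coeff χ a x) := (Finsupp.sum_single x).symm
  have hy : y = ∑ b ∈ Finsupp.support y, single χ b (coeff χ b y) := (Finsupp.sum_single y).symm
  have key : x * y = ∑ a ∈ Finsupp.support x, ∑ b ∈ Finsupp.support y,
      (χ a b : k) • single χ (a + b) (coeff χ a x * coeff χ b y) := by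
    conv_lhs => rw [hx, hy, Finset.sum_mul_sum]
    simp only [single_mul_single]
  rw [key]
  simp only [map_sum, map_smul, coeff_single]
  rw [Finset.sum_eq_single g, Finset.sum_eq_single h]
  · simp
  · intro b hb hne
    by_cases hg : g ∈ Finsupp.support x
    · rw [if_neg, smul_zero]
      exact fun e => hne (H hg hb e).2
    · have : coeff χ g x = 0 := Finsupp.notMem_support_iff.mp hg
      simp [this]
  · intro hh
    have : coeff χ h y = 0 := Finsupp.notMem_support_iff.mp hh
    simp [this]
  · intro a ha hne
    refine Finset.sum_eq_zero fun b hb => ?_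
    rw [if_neg, smul_zero]
    exact fun e => hne (H ha hb e).1
  · intro hg
    have : coeff χ g x = 0 := Finsupp.notMem_support_iff.mp hg
    simp [this]

instance [NoZeroDivisors A] [UniqueSums G] : NoZeroDivisors (TwistedAlgebra χ A) where
  eq_zero_or_eq_zero_of_mul_eq_zero {x y} hxy := by
    by_contra! hne
    obtain ⟨g, hg, h, hh, H⟩ := UniqueSums.uniqueAdd_of_nonempty
      (Finsupp.support_nonempty_iff.mpr hne.1) (Finsupp.support_nonempty_iff.mpr hne.2)
    have := coeff_mul_of_uniqueAdd χ H
    rw [hxy, map_zero] at this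
    exact smul_ne_zero (χ g h).ne_zero
      (mul_ne_zero (Finsupp.mem_support_iff.mp hg) (Finsupp.mem_support_iff.mp hh)) this.symm

lemma linearIndependent_single {J I : Type*} {v : I → A} (hv : LinearIndependent k v)
    {d : J → G} {e : J → I} (hde : Function.Injective fun j => (d j, e j)) :
    LinearIndependent k fun j => single χ (d j) (v (e j)) := by
  have h := Finsupp.linearIndependent_single (R := k) (fun _ : G => v) fun _ => hv
  refine h.comp (fun j => ⟨d j, e j⟩) fun i j hij => hde ?_
  simpa using hij

end TwistedAlgebra

/-- The entries of the family `t` satisfy the defining relations of quantum matrices. -/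
structure IsQMatrix_s14 {k A I J : Type*} [Field k] [Ring A] [Algebra k A] [LinearOrder I]
    [LinearOrder J] (q : k) (t : I → J → A) : Prop where
  row : ∀ a {c d}, c < d → t a c * t a d = q • (t a d * t a c)
  col : ∀ {a b} c, a < b → t a c * t b c = q • (t b c * t a c)
  cross : ∀ {a b c d}, a < b → c < d →
    t a c * t b d = t b d * t a c + (q - q⁻¹) • (t b c * t a d)
  comm : ∀ {a b c d}, a < b → d < c → t a c * t b d = t b d * t a c

namespace IsQMatrix_s14

lemma sum_mul_sum {A I J K : Type*} [Ring A] [Fintype J] {t : I → J → A} {l : J → K → A}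
    (hcomm : ∀ a f g c, Commute (l g c) (t a f))
    (a b : I) (c d : K) :
    (∑ f, t a f * l f c) * (∑ g, t b g * l g d) =
      ∑ f, ∑ g, t a f * t b g * (l f c * l g d) := by
  rw [Finset.sum_mul_sum]
  refine Finset.sum_congr rfl fun f _ => Finset.sum_congr rfl fun g _ => ?_
  rw [mul_assoc, ← mul_assoc (l f c), (hcomm b g f c).eq]
  simp only [mul_assoc]

variable {k A B I J K : Type*} [Field k] [Ring A] [Algebra k A] [Ring B] [Algebra k B]
  [LinearOrder I] [LinearOrder J] {q : k}

lemma map {t : I → J → A} (ht : IsQMatrix_s14 q t) (φ : A →ₐ[k] B) :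
    IsQMatrix_s14 q fun a c => φ (t a c) where
  row a _ _ h := by simp only [← map_mul, ht.row a h, map_smul]
  col c h := by simp only [← map_mul, ht.col c h, map_smul]
  cross h h' := by simp only [← map_mul, ht.cross h h', map_smul, map_add]
  comm h h' := by simp only [← map_mul, ht.comm h h']

lemma mul_of_lt {t : I → J → A} (ht : IsQMatrix_s14 q t) {a b : I} (hab : a < b) (f g : J) :
    t a f * t b g = (if f = g then q else 1) • (t b g * t a f) +
      (if f < g then q - q⁻¹ else 0) • (t b f * t a g) := by
  rcases lt_trichotomy f g with h | rfl | h
  · simp [h, h.ne, ht.cross hab h]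
  · simp [ht.col f hab]
  · simp [h.ne', h.not_gt, ht.comm hab h]

variable [Fintype J]

lemma sum_mul_sum_of_lt {t : I → J → A} (ht : IsQMatrix_s14 q t) {l : J → K → A}
    (hcomm : ∀ a f g c, Commute (l g c) (t a f)) {a b : I} (hab : a < b) (c d : K) :
    (∑ f, t a f * l f c) * (∑ g, t b g * l g d) =
      ∑ g, ∑ f, t b g * t a f * ((if f = g then q else 1) • (l f c * l g d) +
        (if g < f then q - q⁻¹ else 0) • (l g c * l f d)) := by
  rw [sum_mul_sum hcomm]
  simp only [ht.mul_of_lt hab, add_mul, mul_add, Finset.sum_add_distrib, smul_mul_assoc,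
    mul_smul_comm]
  congr 1
  exact Finset.sum_comm

lemma mul [LinearOrder K] (hq : q ≠ 0) {t : I → J → A} (ht : IsQMatrix_s14 q t) {l : J → K → A}
    (hl : IsQMatrix_s14 q l) (hcomm : ∀ a f g c, Commute (l g c) (t a f)) :
    IsQMatrix_s14 q fun a c => ∑ f, t a f * l f c where
  row a c d hcd := by
    rw [sum_mul_sum hcomm, sum_mul_sum hcomm, ← sub_eq_zero, Finset.smul_sum,
      ← Finset.sum_sub_distrib]
    simp only [Finset.smul_sum, ← Finset.sum_sub_distrib]
    rw [← Finset.sum_product']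
    have swap : ∀ f g, f < g →
        (t a f * t a g * (l f c * l g d) - q • (t a f * t a g * (l f d * l g c))) +
        (t a g * t a f * (l g c * l f d) - q • (t a g * t a f * (l g d * l f c))) = 0 := by
      intro f g h
      rw [ht.row a h, hl.cross h hcd, hl.comm h hcd]
      simp only [mul_add, mul_smul_comm, smul_mul_assoc]
      match_scalars <;> field_simp <;> ring
    refine Finset.sum_involution (fun p _ => p.swap) (fun p _ => ?_) (fun p _ hp e => hp ?_)
      (fun _ _ => Finset.mem_univ _) fun _ _ => Prod.swap_swap _
    · rcases lt_trichotomy p.1 p.2 with h | h | h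
      · exact swap _ _ h
      · simp [h, hl.row p.2 hcd]
      · exact (add_comm _ _).trans (swap _ _ h)
    · have h : p.2 = p.1 := congrArg Prod.fst e
      simp [h, hl.row p.1 hcd]
  col {a b} c hab := by
    rw [ht.sum_mul_sum_of_lt hcomm hab, sum_mul_sum hcomm]
    simp only [Finset.smul_sum]
    refine Finset.sum_congr rfl fun g _ => Finset.sum_congr rfl fun f _ => ?_
    rw [← mul_smul_comm q (t b g * t a f)]
    congr 1
    rcases lt_trichotomy f g with h | rfl | h
    · simp [h.ne, h.not_gt, hl.col c h]
    · simp
    · simp only [h, h.ne', hl.col c h, if_true, if_false]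
      match_scalars
      field_simp
      ring
  cross {a b c d} hab hcd := by
    rw [ht.sum_mul_sum_of_lt hcomm hab, sum_mul_sum hcomm, sum_mul_sum hcomm]
    simp only [Finset.smul_sum, ← Finset.sum_add_distrib]
    refine Finset.sum_congr rfl fun g _ => Finset.sum_congr rfl fun f _ => ?_
    rw [← mul_smul_comm (q - q⁻¹), ← mul_add]
    congr 1
    rcases lt_trichotomy f g with h | rfl | h
    · simp [h.ne, h.not_gt, hl.cross h hcd]
    · simp only [hl.row f hcd, lt_irrefl, if_true, if_false]
      match_scalars
      field_simp
      ring
    · simp [h, h.ne', hl.comm h hcd]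
  comm {a b c d} hab hdc := by
    rw [ht.sum_mul_sum_of_lt hcomm hab, sum_mul_sum hcomm]
    refine Finset.sum_congr rfl fun g _ => Finset.sum_congr rfl fun f _ => ?_
    congr 1
    rcases lt_trichotomy f g with h | rfl | h
    · simp [h.ne, h.not_gt, hl.comm h hdc]
    · simp [hl.row f hdc]
    · simp [h, h.ne', hl.cross h hdc, hl.comm h hdc]

end IsQMatrix_s14

/-- The bicharacter `(g, h) ↦ q ^ (gᵀ M h)` on exponent vectors. -/
def Bicharacter.ofMatrix {k ι : Type*} [Field k] [Fintype ι] (q : kˣ) (M : Matrix ι ι ℤ) :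
    Bicharacter k (ι → ℕ) where
  toFun g h := q ^ (∑ i, ∑ j, (g i : ℤ) * M i j * h j)
  add_left a b c := by
    rw [← zpow_add]
    simp only [Pi.add_apply, Nat.cast_add, add_mul, Finset.sum_add_distrib]
  add_right a b c := by
    rw [← zpow_add]
    simp only [Pi.add_apply, Nat.cast_add, mul_add, Finset.sum_add_distrib]

lemma Bicharacter.ofMatrix_single {k ι : Type*} [Field k] [Fintype ι] [DecidableEq ι] (q : kˣ)
    (M : Matrix ι ι ℤ) (i j : ι) :
    Bicharacter.ofMatrix q M (Pi.single i 1) (Pi.single j 1) = q ^ M i j := by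
  simp [Bicharacter.ofMatrix, Pi.single_apply]

/-- The commutation exponents of the generators `y_c` and `z_f` of a quantum affine space in
which the truncated products `y_c z_f` with `c ≤ f` form a quantum matrix. -/
def stairMatrix (n : ℕ) : Matrix (Fin n ⊕ Fin (n + 1)) (Fin n ⊕ Fin (n + 1)) ℤ
  | .inl c, .inl d => if c < d then 1 else 0
  | .inl _, .inr _ => 0
  | .inr f, .inl c => if c.castSucc ≤ f then 1 else -1
  | .inr f, .inr g => if f < g then 1 else 0

section Stair

variable {k A : Type*} [Field k] [Ring A] [Algebra k A] (q : kˣ) {n : ℕ}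

/-- The exponent vector of `y_c z_f`. -/
def stairExp (f : Fin (n + 1)) (c : Fin n) : Fin n ⊕ Fin (n + 1) → ℕ :=
  Pi.single (.inl c) 1 + Pi.single (.inr f) 1

/-- The quantum affine space on the generators `y_c` and `z_f` with coefficients in `A`. -/
abbrev StairAlgebra (n : ℕ) (A : Type*) [Ring A] : Type _ :=
  TwistedAlgebra (Bicharacter.ofMatrix q (stairMatrix n)) A

open Polynomial in
/-- The truncated rank one quantum matrix with entries `X ^ (f - c) y_c z_f` for `c ≤ f`. -/
noncomputable def stair (f : Fin (n + 1)) (c : Fin n) : (StairAlgebra q n A)[X] :=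
  if c.castSucc ≤ f then
    monomial ((f : ℕ) - c)
      (TwistedAlgebra.single (Bicharacter.ofMatrix q (stairMatrix n)) (stairExp f c) (1 : A))
  else 0

open Polynomial in
/-- The monomial `X ^ (f + g - c - d) y_c y_d z_f z_g`. -/
noncomputable def stairPair (f g : Fin (n + 1)) (c d : Fin n) : (StairAlgebra q n A)[X] :=
  monomial (((f : ℕ) + g) - (c + d)) (TwistedAlgebra.single
    (Bicharacter.ofMatrix q (stairMatrix n))
    (Pi.single (.inl c) 1 + Pi.single (.inl d) 1 +
      (Pi.single (.inr f) 1 + Pi.single (.inr g) 1)) (1 : A))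

lemma stairPair_swap_row (f g : Fin (n + 1)) (c d : Fin n) :
    stairPair (A := A) q g f c d = stairPair q f g c d := by
  rw [stairPair, stairPair, add_comm (g : ℕ),
    add_comm (Pi.single (.inr g) 1 : Fin n ⊕ Fin (n + 1) → ℕ)]

lemma stairPair_swap_col (f g : Fin (n + 1)) (c d : Fin n) :
    stairPair (A := A) q f g d c = stairPair q f g c d := by
  rw [stairPair, stairPair, add_comm (d : ℕ),
    add_comm (Pi.single (.inl d) 1 : Fin n ⊕ Fin (n + 1) → ℕ)]

open Polynomial in
lemma stair_mul_stair {f g : Fin (n + 1)} {c d : Fin n} (hf : c.castSucc ≤ f)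
    (hg : d.castSucc ≤ g) {e : ℤ}
    (he : (if c < d then 1 else 0) + (if d.castSucc ≤ f then 1 else -1) +
      (if f < g then 1 else 0) = e) :
    stair (A := A) q f c * stair q g d = ((q : k) ^ e) • stairPair q f g c d := by
  have hf' : (c : ℕ) ≤ f := hf
  have hg' : (d : ℕ) ≤ g := hg
  rw [stair, stair, if_pos hf, if_pos hg, monomial_mul_monomial,
    TwistedAlgebra.single_mul_single, ← smul_monomial]
  have h₁ : (f : ℕ) - c + (g - d) = f + g - (c + d) := by omega
  rw [h₁, mul_one, stairExp, stairExp, add_add_add_comm, stairPair, ← he,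
    ← Units.val_zpow_eq_zpow_val]
  simp only [Bicharacter.add_left, Bicharacter.add_right, Bicharacter.ofMatrix_single, stairMatrix,
    ← zpow_add]
  congr 3
  ring

lemma isQMatrix_stair : IsQMatrix_s14 (q : k) (stair q (n := n) (A := A)) where
  row a c d hcd := by
    by_cases hd : d.castSucc ≤ a
    · have hc : c.castSucc ≤ a := (Fin.castSucc_lt_castSucc_iff.mpr hcd).le.trans hd
      rw [stair_mul_stair q hc hd (e := 2) (by simp [hcd, hd]),
        stair_mul_stair q hd hc (e := 1) (by simp [hcd.not_gt, hc]), stairPair_swap_col, smul_smul,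
        ← zpow_one_add₀ q.ne_zero]
      rfl
    · simp [stair, hd]
  col {a b} c hab := by
    by_cases hc : c.castSucc ≤ a
    · have hb := hc.trans hab.le
      rw [stair_mul_stair q hc hb (e := 2) (by simp [hc, hab]),
        stair_mul_stair q hb hc (e := 1) (by simp [hb, hab.not_gt]), stairPair_swap_row, smul_smul,
        ← zpow_one_add₀ q.ne_zero]
      rfl
    · simp [stair, hc]
  cross {a b c d} hab hcd := by
    have hcd' := Fin.castSucc_lt_castSucc_iff.mpr hcd
    by_cases hc : c.castSucc ≤ a
    · have hbc := hc.trans hab.le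
      by_cases hd : d.castSucc ≤ b
      · rw [stair_mul_stair q hd hc (e := 1) (by simp [hcd.not_gt, hbc, hab.not_gt]),
          stairPair_swap_col, stairPair_swap_row]
        by_cases had : d.castSucc ≤ a
        · rw [stair_mul_stair q hc hd (e := 3) (by simp [hcd, had, hab]),
            stair_mul_stair q hbc had (e := 2) (by simp [hcd, hd, hab.not_gt]),
            stairPair_swap_row]
          have hq := q.ne_zero
          match_scalars
          simp only [zpow_ofNat]
          field_simp
          ring
        · rw [stair_mul_stair q hc hd (e := 1) (by simp [hcd, had, hab])]
          simp [stair, had]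
      · have had : ¬ d.castSucc ≤ a := fun h => hd (h.trans hab.le)
        simp [stair, hd, had]
    · have had : ¬ d.castSucc ≤ a := fun h => hc (hcd'.le.trans h)
      simp [stair, hc, had]
  comm {a b c d} hab hdc := by
    have hdc' := Fin.castSucc_lt_castSucc_iff.mpr hdc
    by_cases hc : c.castSucc ≤ a
    · have hda := hdc'.le.trans hc
      rw [stair_mul_stair q hc (hda.trans hab.le) (e := 2) (by simp [hdc.not_gt, hda, hab]),
        stair_mul_stair q (hda.trans hab.le) hc (e := 2)
          (by simp [hdc, hc.trans hab.le, hab.not_gt]),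
        stairPair_swap_row, stairPair_swap_col]
    · simp [stair, hc]

end Stair

open Polynomial in
lemma linearIndependent_of_eq_X_pow_mul {k R I : Type*} [Field k] [Ring R] [Algebra k R]
    {v u : I → R[X]} {e : I → ℕ} (hv : ∀ i, v i = X ^ e i * u i)
    (hu : LinearIndependent k fun i => constantCoeff (u i)) : LinearIndependent k v := by
  rw [linearIndependent_iff']
  intro s g hg
  suffices ∀ N, ∀ i ∈ s, e i = N → g i = 0 from fun i hi => this _ i hi rfl
  intro N
  induction N using Nat.strong_induction_on with
  | _ N ih =>
    have hN : ∑ i ∈ s, (if e i = N then g i else 0) • constantCoeff (u i) = 0 := by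
      have := congrArg (fun p => coeff p N) hg
      simp only [finsetSum_coeff, coeff_smul, coeff_zero, hv, coeff_X_pow_mul'] at this
      rw [← this]
      refine Finset.sum_congr rfl fun i hi => ?_
      rcases lt_trichotomy (e i) N with h | h | h
      · simp [h.ne, ih _ h i hi rfl]
      · simp [h]
      · simp [h.ne', h.not_ge]
    intro i hi hei
    have := linearIndependent_iff'.mp hu s _ hN i hi
    rwa [if_pos hei] at this

/-- The monomial in the entries of `t` with exponents `α`, ordered row by row. -/
def orderedMonomial {A : Type*} [Monoid A] {m n : ℕ} (t : Fin m → Fin n → A)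
    (α : Fin m → Fin n → ℕ) : A :=
  (List.ofFn fun a => (List.ofFn fun c => t a c ^ α a c).prod).prod

lemma map_orderedMonomial {A B F : Type*} [Monoid A] [Monoid B] [FunLike F A B]
    [MonoidHomClass F A B] (φ : F) {m n : ℕ} (t : Fin m → Fin n → A) (α : Fin m → Fin n → ℕ) :
    φ (orderedMonomial t α) = orderedMonomial (fun a c => φ (t a c)) α := by
  simp [orderedMonomial, map_list_prod, List.map_ofFn, Function.comp_def]

section Leading

open Polynomial

variable {k G A : Type*} [Field k] [AddCommMonoid G] (χ : Bicharacter k G) [Ring A] [Algebra k A]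

/-- The lowest term of `x` in `X` is, up to a nonzero scalar, `X ^ e` times the monomial of degree
`g` with coefficient `a`. -/
def HasLowestTerm (e : ℕ) (g : G) (a : A) (x : (TwistedAlgebra χ A)[X]) : Prop :=
  ∃ (r : kˣ) (u : (TwistedAlgebra χ A)[X]),
    x = X ^ e * u ∧ constantCoeff u = (r : k) • TwistedAlgebra.single χ g a

variable {χ}

namespace HasLowestTerm

lemma one : HasLowestTerm χ 0 0 (1 : A) 1 :=
  ⟨1, 1, by simp, by simp [TwistedAlgebra.one_def]⟩

lemma mul {e e' : ℕ} {g g' : G} {a a' : A} {x x' : (TwistedAlgebra χ A)[X]}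
    (h : HasLowestTerm χ e g a x) (h' : HasLowestTerm χ e' g' a' x') :
    HasLowestTerm χ (e + e') (g + g') (a * a') (x * x') := by
  obtain ⟨r, u, rfl, hu⟩ := h
  obtain ⟨r', u', rfl, hu'⟩ := h'
  refine ⟨r * r' * χ g g', u * u', ?_, ?_⟩
  · rw [pow_add, mul_assoc, ← mul_assoc u, ← (commute_X_pow u e').eq]
    simp only [mul_assoc]
  · rw [map_mul, hu, hu', smul_mul_smul_comm, TwistedAlgebra.single_mul_single, smul_smul]
    push_cast
    rfl

lemma pow {e : ℕ} {g : G} {a : A} {x : (TwistedAlgebra χ A)[X]}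
    (h : HasLowestTerm χ e g a x) (N : ℕ) : HasLowestTerm χ (N * e) (N • g) (a ^ N) (x ^ N) := by
  induction N with
  | zero => simpa using one
  | succ N ih =>
    rw [add_mul, one_mul, succ_nsmul, pow_succ, pow_succ]
    exact ih.mul h

lemma list_prod {N : ℕ} {e : Fin N → ℕ} {g : Fin N → G} {a : Fin N → A}
    {x : Fin N → (TwistedAlgebra χ A)[X]} (h : ∀ i, HasLowestTerm χ (e i) (g i) (a i) (x i)) :
    HasLowestTerm χ (∑ i, e i) (∑ i, g i) (List.ofFn a).prod (List.ofFn x).prod := by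
  induction N with
  | zero => simpa using one
  | succ N ih =>
    rw [Fin.sum_univ_succ, Fin.sum_univ_succ, List.ofFn_succ, List.ofFn_succ, List.prod_cons,
      List.prod_cons]
    exact (h 0).mul (ih fun i => h i.succ)

lemma orderedMonomial {m n : ℕ} {e : Fin m → Fin n → ℕ} {g : Fin m → Fin n → G}
    {a : Fin m → Fin n → A} {x : Fin m → Fin n → (TwistedAlgebra χ A)[X]}
    (h : ∀ i j, HasLowestTerm χ (e i j) (g i j) (a i j) (x i j)) (α : Fin m → Fin n → ℕ) :
    HasLowestTerm χ (∑ i, ∑ j, α i j * e i j) (∑ i, ∑ j, α i j • g i j)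
      (orderedMonomial a α) (orderedMonomial x α) :=
  list_prod fun i => list_prod fun j => (h i j).pow _

end HasLowestTerm

lemma linearIndependent_of_hasLowestTerm {I J : Type*} {v : I → A} (hv : LinearIndependent k v)
    {d : J → G} {i : J → I} (hdi : Function.Injective fun j => (d j, i j)) {e : J → ℕ}
    {x : J → (TwistedAlgebra χ A)[X]} (h : ∀ j, HasLowestTerm χ (e j) (d j) (v (i j)) (x j)) :
    LinearIndependent k x := by
  choose r u hx hu using h
  refine linearIndependent_of_eq_X_pow_mul hx ?_
  simp only [hu]
  exact (TwistedAlgebra.linearIndependent_single χ hv hdi).units_smul r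

end Leading

section Extend

open Polynomial

universe u

variable {k A : Type*} [Field k] [Ring A] [Algebra k A] (q : kˣ) {m n : ℕ}

/-- The block diagonal matrix with blocks `t` and `1`. -/
def cornerMatrix (t : Fin m → Fin n → A) : Fin (m + 1) → Fin (n + 1) → A :=
  Fin.snoc (α := fun _ => Fin (n + 1) → A) (fun a => Fin.snoc (α := fun _ => A) (t a) 0)
    (Fin.snoc (α := fun _ => A) 0 1)

@[simp] lemma cornerMatrix_castSucc_castSucc (t : Fin m → Fin n → A) (a : Fin m) (f : Fin n) :
    cornerMatrix t a.castSucc f.castSucc = t a f := by simp [cornerMatrix]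

@[simp] lemma cornerMatrix_castSucc_last (t : Fin m → Fin n → A) (a : Fin m) :
    cornerMatrix t a.castSucc (Fin.last n) = 0 := by simp [cornerMatrix]

@[simp] lemma cornerMatrix_last_castSucc (t : Fin m → Fin n → A) (f : Fin n) :
    cornerMatrix t (Fin.last m) f.castSucc = 0 := by simp [cornerMatrix]

@[simp] lemma cornerMatrix_last_last (t : Fin m → Fin n → A) :
    cornerMatrix t (Fin.last m) (Fin.last n) = 1 := by simp [cornerMatrix]

lemma IsQMatrix_s14.cornerMatrix {q : k} {t : Fin m → Fin n → A} (ht : IsQMatrix_s14 q t) :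
    IsQMatrix_s14 q (cornerMatrix t) where
  row a c d hcd := by
    induction c using Fin.lastCases with
    | last => exact absurd hcd (Fin.le_last _).not_gt
    | cast c =>
    induction a using Fin.lastCases with
    | last => simp
    | cast a =>
    induction d using Fin.lastCases with
    | last => simp
    | cast d => simpa using ht.row a (Fin.castSucc_lt_castSucc_iff.mp hcd)
  col {a b} c hab := by
    induction a using Fin.lastCases with
    | last => exact absurd hab (Fin.le_last _).not_gt
    | cast a =>
    induction c using Fin.lastCases with
    | last => simp
    | cast c =>
    induction b using Fin.lastCases with
    | last => simp
    | cast b => simpa using ht.col c (Fin.castSucc_lt_castSucc_iff.mp hab)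
  cross {a b c d} hab hcd := by
    induction a using Fin.lastCases with
    | last => exact absurd hab (Fin.le_last _).not_gt
    | cast a =>
    induction c using Fin.lastCases with
    | last => exact absurd hcd (Fin.le_last _).not_gt
    | cast c =>
    induction b using Fin.lastCases with
    | last => induction d using Fin.lastCases <;> simp
    | cast b =>
    induction d using Fin.lastCases with
    | last => simp
    | cast d =>
      simpa using ht.cross (Fin.castSucc_lt_castSucc_iff.mp hab)
        (Fin.castSucc_lt_castSucc_iff.mp hcd)
  comm {a b c d} hab hdc := by
    induction a using Fin.lastCases with
    | last => exact absurd hab (Fin.le_last _).not_gt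
    | cast a =>
    induction d using Fin.lastCases with
    | last => exact absurd hdc (Fin.le_last _).not_gt
    | cast d =>
    induction b using Fin.lastCases with
    | last => simp
    | cast b =>
    induction c using Fin.lastCases with
    | last => simp
    | cast c =>
      simpa using ht.comm (Fin.castSucc_lt_castSucc_iff.mp hab)
        (Fin.castSucc_lt_castSucc_iff.mp hdc)

/-- The embedding of the coefficients as constants. -/
noncomputable def stairConst : A →ₐ[k] (StairAlgebra q n A)[X] :=
  CAlgHom.comp (AlgHom.ofLinearMap (TwistedAlgebra.single _ 0) rfl fun a b => by
    simp [TwistedAlgebra.single_mul_single])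

lemma stairConst_mul_stair (a : A) (f : Fin (n + 1)) (c : Fin n) :
    stairConst q a * stair q f c = if c.castSucc ≤ f then
      monomial ((f : ℕ) - c) (TwistedAlgebra.single _ (stairExp f c) a) else 0 := by
  have : stairConst q a = C (TwistedAlgebra.single (Bicharacter.ofMatrix q (stairMatrix n)) 0 a) :=
    rfl
  rw [stair, this]
  split_ifs
  · rw [C_mul_monomial, TwistedAlgebra.single_mul_single]
    simp
  · simp

lemma commute_stair_stairConst (a : A) (f : Fin (n + 1)) (c : Fin n) :
    Commute (stair q f c) (stairConst q a) := by
  have : stairConst q a = C (TwistedAlgebra.single (Bicharacter.ofMatrix q (stairMatrix n)) 0 a) :=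
    rfl
  rw [Commute, SemiconjBy, stairConst_mul_stair, stair, this]
  split_ifs
  · rw [monomial_mul_C, TwistedAlgebra.single_mul_single]
    simp
  · simp

/-- The quantum matrix with one more row than `t`, obtained by multiplying the block diagonal
matrix of `t` and `1` with the staircase matrix. -/
noncomputable def extendRow (t : Fin m → Fin n → A) (a : Fin (m + 1)) (c : Fin n) :
    (StairAlgebra q n A)[X] :=
  ∑ f, stairConst q (cornerMatrix t a f) * stair q f c

lemma IsQMatrix_s14.extendRow {t : Fin m → Fin n → A} (ht : IsQMatrix_s14 (q : k) t) :
    IsQMatrix_s14 (q : k) (extendRow q t) :=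
  (ht.cornerMatrix.map (stairConst q)).mul q.ne_zero (isQMatrix_stair q)
    fun _ _ _ _ => commute_stair_stairConst q _ _ _

lemma hasLowestTerm_extendRow_castSucc (t : Fin m → Fin n → A) (a : Fin m) (c : Fin n) :
    HasLowestTerm (Bicharacter.ofMatrix q (stairMatrix n)) 0 (stairExp c.castSucc c) (t a c)
      (extendRow q t a.castSucc c) := by
  refine ⟨1, _, by rw [pow_zero, one_mul], ?_⟩
  rw [extendRow, map_sum, Finset.sum_eq_single c.castSucc]
  · simp [stairConst_mul_stair]
  · intro f _ hf
    rw [stairConst_mul_stair]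
    split_ifs with h
    · have h₁ : (c : ℕ) < f := lt_of_le_of_ne h fun e => hf (Fin.ext e.symm)
      rw [constantCoeff_apply, coeff_monomial, if_neg (by omega)]
    · simp
  · simp

lemma hasLowestTerm_extendRow_last (t : Fin m → Fin n → A) (c : Fin n) :
    HasLowestTerm (Bicharacter.ofMatrix q (stairMatrix n)) (n - c) (stairExp (Fin.last n) c) 1
      (extendRow q t (Fin.last m) c) := by
  refine ⟨1, C (TwistedAlgebra.single _ (stairExp (Fin.last n) c) 1), ?_, by simp⟩
  rw [extendRow, Fin.sum_univ_castSucc]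
  simp [stair, Fin.le_last, X_pow_mul_C, C_mul_X_pow_eq_monomial]

lemma linearIndependent_extendRow {t : Fin m → Fin n → A}
    (ht : LinearIndependent k (orderedMonomial t)) :
    LinearIndependent k (orderedMonomial (extendRow q t)) := by
  let e : Fin (m + 1) → Fin n → ℕ :=
    Fin.snoc (α := fun _ => Fin n → ℕ) (fun _ _ => 0) fun c => n - c
  let g : Fin (m + 1) → Fin n → Fin n ⊕ Fin (n + 1) → ℕ :=
    Fin.snoc (α := fun _ => Fin n → Fin n ⊕ Fin (n + 1) → ℕ) (fun _ c => stairExp c.castSucc c)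
      fun c => stairExp (Fin.last n) c
  let s : Fin (m + 1) → Fin n → A := Fin.snoc (α := fun _ => Fin n → A) t fun _ => 1
  have hs (α : Fin (m + 1) → Fin n → ℕ) :
      orderedMonomial s α = orderedMonomial t fun a => α a.castSucc := by
    simp [orderedMonomial, s, List.ofFn_succ_last, -List.ofFn_succ, List.ofFn_const]
  have h : ∀ a c, HasLowestTerm (Bicharacter.ofMatrix q (stairMatrix n)) (e a c) (g a c) (s a c)
      (extendRow q t a c) := by
    intro a c
    induction a using Fin.lastCases with
    | last => simpa [e, g, s] using hasLowestTerm_extendRow_last q t c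
    | cast a => simpa [e, g, s] using hasLowestTerm_extendRow_castSucc q t a c
  refine linearIndependent_of_hasLowestTerm ht (i := fun α a => α a.castSucc) ?_ fun α =>
    hs α ▸ HasLowestTerm.orderedMonomial h α
  intro α β hαβ
  obtain ⟨hd, hi⟩ := Prod.mk.inj hαβ
  have hi' (a : Fin m) : α a.castSucc = β a.castSucc := congrFun hi a
  rw [Fin.sum_univ_castSucc, Fin.sum_univ_castSucc] at hd
  simp only [hi'] at hd
  have hd' := add_left_cancel hd
  funext a
  induction a using Fin.lastCases with
  | cast a => exact hi' a
  | last =>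
    funext c
    simpa [g, stairExp, Pi.single_apply, Finset.sum_apply] using congrFun hd' (.inl c)

theorem exists_isQMatrix_linearIndependent {k : Type u} [Field k] (q : kˣ) (m n : ℕ) :
    ∃ (A : Type u) (_ : Ring A) (_ : Algebra k A) (t : Fin m → Fin n → A),
      NoZeroDivisors A ∧ IsQMatrix_s14 (q : k) t ∧ LinearIndependent k (orderedMonomial t) := by
  induction m with
  | zero =>
    refine ⟨k, inferInstance, inferInstance, fun _ _ => 0, inferInstance, ?_, ?_⟩
    · exact ⟨fun a => a.elim0, fun {a} => a.elim0, fun {a} => a.elim0, fun {a} => a.elim0⟩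
    · exact LinearIndependent.of_subsingleton default (by simp [orderedMonomial])
  | succ m ih =>
    obtain ⟨A, _, _, t, _, ht, hli⟩ := ih
    exact ⟨(StairAlgebra q n A)[X], inferInstance, inferInstance, extendRow q t, inferInstance,
      ht.extendRow q, linearIndependent_extendRow q hli⟩

end Extend

section Spanning

open Submodule

variable {k A : Type*} [Field k] [Ring A] [Algebra k A]

lemma mul_prod_ofFn_le {N : ℕ} (U : Submodule k A) (W : Fin N → Submodule k A) (i : Fin N)
    (hlt : ∀ j < i, U * W j ≤ W j * U) (hi : U * W i ≤ W i) :
    U * (List.ofFn W).prod ≤ (List.ofFn W).prod := by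
  induction N with
  | zero => exact i.elim0
  | succ N ih =>
    rw [List.ofFn_succ, List.prod_cons, ← mul_assoc]
    induction i using Fin.cases with
    | zero => exact mul_le_mul' hi le_rfl
    | succ i =>
      refine (mul_le_mul' (hlt 0 i.succ_pos) le_rfl).trans ?_
      rw [mul_assoc]
      exact mul_le_mul' le_rfl
        (ih (fun j => W j.succ) i (fun j hj => hlt _ (Fin.succ_lt_succ_iff.mpr hj)) hi)

lemma one_mem_prod_ofFn {N : ℕ} (W : Fin N → Submodule k A) (h : ∀ i, 1 ∈ W i) :
    1 ∈ (List.ofFn W).prod := by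
  induction N with
  | zero => simpa using ⟨1, map_one _⟩
  | succ N ih =>
    rw [List.ofFn_succ, List.prod_cons]
    exact one_mul (1 : A) ▸ mul_mem_mul (h 0) (ih _ fun i => h i.succ)

lemma prod_ofFn_le_span {N : ℕ} {J : Type*} {W : Fin N → Submodule k A} {v : Fin N → J → A}
    (h : ∀ i, W i ≤ span k (Set.range (v i))) :
    (List.ofFn W).prod ≤
      span k (Set.range fun α : Fin N → J => (List.ofFn fun i => v i (α i)).prod) := by
  induction N with
  | zero => simp [one_eq_span]
  | succ N ih =>
    rw [List.ofFn_succ, List.prod_cons]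
    refine (mul_le_mul' (h 0) (ih fun i => h i.succ)).trans ?_
    rw [span_mul_span]
    refine span_mono (Set.mul_subset_iff.mpr ?_)
    rintro _ ⟨j, rfl⟩ _ ⟨α, rfl⟩
    exact ⟨Fin.cons j α, by simp [List.ofFn_succ]⟩

lemma mul_adjoin_le {S : Set A} {U : Submodule k A} (h : U * span k S ≤ span k S * U) :
    U * Subalgebra.toSubmodule (Algebra.adjoin k S) ≤
      Subalgebra.toSubmodule (Algebra.adjoin k S) * U := by
  refine mul_le.mpr fun u hu x hx => ?_
  replace hx : x ∈ Algebra.adjoin k S := hx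
  induction hx using Algebra.adjoin_induction generalizing u with
  | mem x hx =>
    exact mul_le_mul' (Algebra.span_le_adjoin k S) le_rfl
      (h (mul_mem_mul hu (subset_span hx)))
  | algebraMap r =>
    rw [← Algebra.commutes]
    exact mul_mem_mul (Subalgebra.algebraMap_mem _ r) hu
  | add x y _ _ hx hy => exact mul_add u x y ▸ add_mem (hx u hu) (hy u hu)
  | mul x y _ _ hx hy =>
    rw [← mul_assoc]
    refine Submodule.mul_induction_on (hx u hu) (fun a ha v hv => ?_) fun a b ha hb => ?_
    · rw [mul_assoc]
      refine Submodule.mul_induction_on (hy v hv) (fun b hb w hw => ?_) fun b c hb hc => ?_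
      · rw [← mul_assoc]
        exact mul_mem_mul (mul_mem (S := Subalgebra k A) ha hb) hw
      · exact mul_add a b c ▸ add_mem hb hc
    · exact add_mul a b y ▸ add_mem ha hb

lemma adjoin_iUnion_le_prod {N : ℕ} (S : Fin N → Set A)
    (h : ∀ i, ∀ j < i, span k (S i) * span k (S j) ≤ span k (S j) * span k (S i)) :
    Subalgebra.toSubmodule (Algebra.adjoin k (⋃ i, S i)) ≤
      (List.ofFn fun i => Subalgebra.toSubmodule (Algebra.adjoin k (S i))).prod := by
  set P := (List.ofFn fun i => Subalgebra.toSubmodule (Algebra.adjoin k (S i))).prod with hP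
  have hone : 1 ∈ P := one_mem_prod_ofFn _ fun i => one_mem (Algebra.adjoin k (S i))
  suffices ∀ x ∈ Algebra.adjoin k (⋃ i, S i), ∀ p ∈ P, x * p ∈ P from
    fun x hx => mul_one x ▸ this x hx 1 hone
  intro x hx
  induction hx using Algebra.adjoin_induction with
  | mem x hx =>
    obtain ⟨i, hi⟩ := Set.mem_iUnion.mp hx
    intro p hp
    refine mul_prod_ofFn_le (span k (S i)) _ i (fun j hj => mul_adjoin_le (h i j hj)) ?_
      (mul_mem_mul (subset_span hi) hp)
    refine mul_le.mpr fun u hu v hv => ?_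
    exact mul_mem (S := Subalgebra k A) (Algebra.span_le_adjoin k _ hu) hv
  | algebraMap r => exact fun p hp => (Algebra.smul_def r p) ▸ smul_mem P r hp
  | add x y _ _ hx hy => exact fun p hp => add_mul x y p ▸ add_mem (hx p hp) (hy p hp)
  | mul x y _ _ hx hy => exact fun p hp => mul_assoc x y p ▸ hx _ (hy p hp)

lemma adjoin_singleton_le_span_pow (x : A) :
    Subalgebra.toSubmodule (Algebra.adjoin k {x}) ≤ span k (Set.range fun i : ℕ => x ^ i) := by
  rw [Algebra.adjoin_eq_span]
  refine span_mono ?_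
  rw [← Submonoid.powers_eq_closure]
  rfl

namespace IsQMatrix_s14

variable {q : k} {m n : ℕ} {t : Fin m → Fin n → A}

lemma adjoin_row_le (hq : q ≠ 0) (ht : IsQMatrix_s14 q t) (a : Fin m) :
    Subalgebra.toSubmodule (Algebra.adjoin k (Set.range (t a))) ≤
      span k (Set.range fun α : Fin n → ℕ => (List.ofFn fun c => t a c ^ α c).prod) := by
  have h := adjoin_iUnion_le_prod (k := k) (fun c => {t a c}) fun d c hcd => by
    rw [span_mul_span, span_mul_span, Set.singleton_mul_singleton, Set.singleton_mul_singleton,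
      span_singleton_le_iff_mem, mem_span_singleton]
    exact ⟨q⁻¹, by rw [ht.row a hcd, smul_smul, inv_mul_cancel₀ hq, one_smul]⟩
  rw [Set.iUnion_singleton_eq_range] at h
  exact h.trans (prod_ofFn_le_span fun c => adjoin_singleton_le_span_pow _)

lemma span_row_mul_span_row_le (hq : q ≠ 0) (ht : IsQMatrix_s14 q t) {a b : Fin m} (hab : a < b) :
    span k (Set.range (t b)) * span k (Set.range (t a)) ≤
      span k (Set.range (t a)) * span k (Set.range (t b)) := by
  have mem (c d : Fin n) :
      t a c * t b d ∈ span k (Set.range (t a)) * span k (Set.range (t b)) :=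
    mul_mem_mul (subset_span ⟨c, rfl⟩) (subset_span ⟨d, rfl⟩)
  conv_lhs => rw [span_mul_span]
  refine span_le.mpr (Set.mul_subset_iff.mpr ?_)
  rintro _ ⟨d, rfl⟩ _ ⟨c, rfl⟩
  rcases lt_trichotomy c d with h | rfl | h
  · have : t b d * t a c = t a c * t b d - (q - q⁻¹) • (t a d * t b c) := by
      rw [ht.cross hab h, ht.comm hab h, add_sub_cancel_right]
    exact this ▸ sub_mem (mem c d) (smul_mem _ _ (mem d c))
  · have : t b c * t a c = q⁻¹ • (t a c * t b c) := by
      rw [ht.col c hab, smul_smul, inv_mul_cancel₀ hq, one_smul]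
    exact this ▸ smul_mem _ _ (mem c c)
  · exact ht.comm hab h ▸ mem c d

lemma adjoin_le_span_orderedMonomial (hq : q ≠ 0) (ht : IsQMatrix_s14 q t) :
    Subalgebra.toSubmodule (Algebra.adjoin k (⋃ a, Set.range (t a))) ≤
      span k (Set.range (orderedMonomial t)) :=
  (adjoin_iUnion_le_prod (fun a => Set.range (t a))
    fun _ _ h => ht.span_row_mul_span_row_le hq h).trans <|
    prod_ofFn_le_span (v := fun a (α : Fin n → ℕ) => (List.ofFn fun c => t a c ^ α c).prod)
      fun a => ht.adjoin_row_le hq a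

end IsQMatrix_s14

end Spanning

section QMat

variable {k : Type*} [Field k] (q : k) (n : ℕ)

lemma isQMatrix_tgen_s14 : IsQMatrix_s14 q (tgen q n) where
  row a c d h := by
    simpa only [tgen, map_mul, map_smul] using RingQuot.mkAlgHom_rel k (QMatRel.row (q := q) a h)
  col c h := by
    simpa only [tgen, map_mul, map_smul] using RingQuot.mkAlgHom_rel k (QMatRel.col (q := q) c h)
  cross h h' := by
    simpa only [tgen, map_mul, map_smul, map_add] using
      RingQuot.mkAlgHom_rel k (QMatRel.cross1 (q := q) h h')
  comm h h' := by
    simpa only [tgen, map_mul] using RingQuot.mkAlgHom_rel k (QMatRel.cross2 (q := q) h h')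

lemma adjoin_tgen : Algebra.adjoin k (⋃ a, Set.range (tgen q n a)) = ⊤ := by
  have h : (⋃ a, Set.range (tgen q n a)) =
      RingQuot.mkAlgHom k (QMatRel k q n) '' Set.range (FreeAlgebra.ι k) := by
    ext x
    simp [tgen]
  rw [h, ← AlgHom.map_adjoin, FreeAlgebra.adjoin_range_ι, Algebra.map_top, AlgHom.range_eq_top]
  exact RingQuot.mkAlgHom_surjective k _

variable {q n}

lemma IsQMatrix_s14.exists_algHom {A : Type*} [Ring A] [Algebra k A] {t : Fin n → Fin n → A}
    (ht : IsQMatrix_s14 q t) : ∃ φ : QMat k q n →ₐ[k] A, ∀ a c, φ (tgen q n a c) = t a c := by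
  refine ⟨RingQuot.liftAlgHom k ⟨FreeAlgebra.lift k fun p => t p.1 p.2, fun x y h => ?_⟩,
    fun a c => by simp [tgen]⟩
  cases h with
  | row a h => simpa using ht.row a h
  | col c h => simpa using ht.col c h
  | cross1 h h' => simpa using ht.cross h h'
  | cross2 h h' => simpa using ht.comm h h'

end QMat

/-- `M_q(n)` has no zero divisors. -/
theorem qMat_noZeroDivisors {k : Type*} [Field k] (q : k) (hq : q ≠ 0) (n : ℕ) :
    ∀ a b : QMat k q n, a * b = 0 → a = 0 ∨ b = 0 := by
  obtain ⟨A, _, _, t, _, ht, hli⟩ := exists_isQMatrix_linearIndependent (Units.mk0 q hq) n n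
  obtain ⟨φ, hφ⟩ := IsQMatrix_s14.exists_algHom (q := q) ht
  have hspan : Submodule.span k (Set.range (orderedMonomial (tgen q n))) = ⊤ := by
    have := (isQMatrix_tgen_s14 q n).adjoin_le_span_orderedMonomial hq
    rwa [adjoin_tgen, Algebra.top_toSubmodule, top_le_iff] at this
  have hmon : φ ∘ orderedMonomial (tgen q n) = orderedMonomial t := by
    funext α
    simp [map_orderedMonomial, hφ]
  have hinj : ∀ x, φ x = 0 → x = 0 := by
    intro x hx
    have hmem : x ∈ Submodule.span k (Set.range (orderedMonomial (tgen q n))) :=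
      hspan ▸ Submodule.mem_top
    obtain ⟨c, rfl⟩ := Finsupp.mem_span_range_iff_exists_finsupp.mp hmem
    have hc : Finsupp.linearCombination k (orderedMonomial t) c = 0 := by
      rw [← hmon, ← hx, map_finsuppSum]
      simp [Finsupp.linearCombination_apply]
    rw [linearIndependent_iff.mp hli c hc, Finsupp.sum_zero_index]
  intro a b hab
  have : φ a * φ b = 0 := by rw [← map_mul, hab, map_zero]
  exact (mul_eq_zero.mp this).imp (hinj a) (hinj b)
end
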